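/- arXiv:2503.20260 — 5 statements merged into one kernel-verified Lean document; each statement's English description precedes it below -/
import Mathlib

section
/- Let n agents and m indivisible items be given, with items partitioned into categories S_1,…,S_k having capacities s_1,…,s_k satisfying |S_h| ≤ n·s_h for all h, and each agent i having an additive integer utility u_i. Then there exist feasible allocations A^(1), A^(2), …, A^(n), each of which is Pareto-optimal, and a subset T of items with |T| ≤ n(n−1), such that for every agent i the allocation A^(i) is envy-free for agent i, and every item outside T is assigned to the same agent in all of A^(1),…,A^(n). (Equivalently: there is a Pareto-optimal allocation together with a set of n(n−1) items such that, for every agent, reallocating only items of this set yields a Pareto-optimal allocation making that agent non-envious.) -/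
/-- Bundle of agent `i'` under allocation `A`. -/
def bundle {n m : ℕ} (A : Fin m → Fin n) (i' : Fin n) : Finset (Fin m) :=
  Finset.univ.filter (fun j => A j = i')

/-- Utility of agent `i` for the bundle of agent `i'` under allocation `A`. -/
def util {n m : ℕ} (u : Fin n → Fin m → ℤ) (A : Fin m → Fin n) (i i' : Fin n) : ℤ :=
  ∑ j ∈ bundle A i', u i j

/-- An allocation is feasible if each agent gets at most `s h` items from category `h`. -/
def IsFeasible {n m k : ℕ} (cat : Fin m → Fin k) (s : Fin k → ℕ) (A : Fin m → Fin n) : Prop :=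
  ∀ (i : Fin n) (h : Fin k), ((bundle A i).filter (fun j => cat j = h)).card ≤ s h

/-- A feasible allocation is Pareto-optimal if no feasible allocation Pareto-dominates it. -/
def IsParetoOptimal {n m k : ℕ} (u : Fin n → Fin m → ℤ) (cat : Fin m → Fin k)
    (s : Fin k → ℕ) (A : Fin m → Fin n) : Prop :=
  IsFeasible cat s A ∧
    ¬ ∃ A' : Fin m → Fin n, IsFeasible cat s A' ∧
        (∀ i, util u A i i ≤ util u A' i i) ∧ (∃ i, util u A i i < util u A' i i)

/-- An allocation is envy-free for agent `i` if `i` envies no agent. -/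
def EnvyFreeFor {n m : ℕ} (u : Fin n → Fin m → ℤ) (A : Fin m → Fin n) (i : Fin n) : Prop :=
  ∀ i', util u A i i' ≤ util u A i i

/-- A finite set `S` is dominated with respect to a family of rankings if no element beats all
of `S` in every ranking. -/
def Dominated {I W : Type*} (r : I → W → ℕ) (S : Finset W) : Prop :=
  ∀ y, ∃ i, ∀ x ∈ S, r i y ≤ r i x

theorem Dominated.mono {I W : Type*} {r : I → W → ℕ} {S T : Finset W} (h : Dominated r S)
    (hTS : T ⊆ S) : Dominated r T := by
  intro y
  obtain ⟨i, hi⟩ := h y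
  exact ⟨i, fun x hx => hi x (hTS hx)⟩

theorem Dominated.exists_unique_pivot {I W : Type*} [Fintype W] [DecidableEq W] {r : I → W → ℕ}
    (hr : ∀ i, Function.Injective (r i)) {T : Finset W} {m : I → W} {a : I}
    (hmT : ∀ i, m i ∈ T) (hmin : ∀ i, ∀ x ∈ T, r i (m i) ≤ r i x) (hT : Dominated r T)
    (hne : ∃ y, ∀ k, k ≠ a → r k (m k) < r k y) :
    ∃ y, (∀ k, k ≠ a → r k (m k) < r k y) ∧ Dominated r (insert y T) ∧
      ∀ y', (∀ k, k ≠ a → r k (m k) < r k y') → Dominated r (insert y' T) → y' = y := by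
  classical
  obtain ⟨y₀, hy₀⟩ := hne
  obtain ⟨y, hy, hmax⟩ := Finset.exists_max_image
    (Finset.univ.filter fun y => ∀ k, k ≠ a → r k (m k) < r k y) (r a) ⟨y₀, by simpa using hy₀⟩
  simp only [Finset.mem_filter, Finset.mem_univ, true_and] at hy hmax
  refine ⟨y, hy, ?_, ?_⟩
  · intro z
    by_cases hz : ∀ k, k ≠ a → r k (m k) < r k z
    · obtain ⟨k, hk⟩ := hT z
      have hka : k = a := by
        by_contra hka
        exact absurd (hk _ (hmT k)) (not_le.2 (hz k hka))
      subst hka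
      refine ⟨k, fun x hx => ?_⟩
      rcases Finset.mem_insert.1 hx with rfl | hx
      · exact hmax z hz
      · exact hk x hx
    · push Not at hz
      obtain ⟨k, hka, hk⟩ := hz
      refine ⟨k, fun x hx => hk.trans ?_⟩
      rcases Finset.mem_insert.1 hx with rfl | hx
      · exact (hy k hka).le
      · exact hmin k x hx
  · intro y' hy' hdom
    obtain ⟨k, hk⟩ := hdom y
    have hka : k = a := by
      by_contra hka
      exact absurd (hk _ (Finset.mem_insert_of_mem (hmT k))) (not_le.2 (hy k hka))
    subst hka
    exact hr k (le_antisymm (hmax y' hy') (hk y' (Finset.mem_insert_self _ _)))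

theorem injOn_compl_of_card_eq {I W : Type*} [Fintype I] [DecidableEq W] {T : Finset W} {m : I → W}
    (hsurj : ∀ x ∈ T, ∃ k, m k = x) (hmT : ∀ i, m i ∈ T) (hcard : T.card + 1 = Fintype.card I)
    {a b : I} (hab : a ≠ b) (hmab : m a = m b) {k l : I} (hk : k ≠ a) (hl : l ≠ a)
    (hkl : m k = m l) : k = l := by
  classical
  have himg : (Finset.univ.erase a).image m = T := by
    ext x
    simp only [Finset.mem_image, Finset.mem_erase, Finset.mem_univ, and_true]
    constructor
    · rintro ⟨i, -, rfl⟩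
      exact hmT i
    · intro hx
      obtain ⟨k, rfl⟩ := hsurj x hx
      by_cases hka : k = a
      · exact ⟨b, hab.symm, by rw [hka, hmab]⟩
      · exact ⟨k, hka, rfl⟩
  have hinj : Set.InjOn m (Finset.univ.erase a : Finset I) := by
    rw [← Finset.card_image_iff, himg, Finset.card_erase_of_mem (Finset.mem_univ a),
      Finset.card_univ]
    omega
  exact hinj (by simpa using hk) (by simpa using hl) hkl

/-- A dominated set with one element fewer than there are rankings, and which is not extremal, is
contained in exactly two dominated sets having as many elements as there are rankings. -/
theorem Dominated.card_rooms_eq_two {I W : Type*} [Fintype I] [Fintype W]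
    [DecidableEq W] {r : I → W → ℕ} (hr : ∀ i, Function.Injective (r i)) {T : Finset W}
    (hT : Dominated r T) (hTne : T.Nonempty) (hcard : T.card + 1 = Fintype.card I)
    (hout : ∀ a, ∃ y, ∀ k, k ≠ a → ∃ x ∈ T, r k x < r k y)
    (R : Finset (Finset W)) (hR : ∀ S, S ∈ R ↔ (T ⊆ S ∧ S.card = Fintype.card I ∧ Dominated r S)) :
    R.card = 2 := by
  classical
  have hex : ∀ i, ∃ x ∈ T, ∀ z ∈ T, r i x ≤ r i z := fun i =>
    Finset.exists_min_image T (r i) hTne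
  choose m hmT hmin using hex
  have huniq : ∀ i x, x ∈ T → (∀ z ∈ T, r i x ≤ r i z) → m i = x := fun i x hx h =>
    hr i (le_antisymm (hmin i x hx) (h _ (hmT i)))
  obtain ⟨a, -, b, -, hab, hmab⟩ := Finset.exists_ne_map_eq_of_card_lt_of_maps_to
    (s := (Finset.univ : Finset I)) (t := T) (f := m) (by rw [Finset.card_univ]; omega)
    (by intro i _; exact hmT i)
  have hsurj : ∀ x ∈ T, ∃ k, m k = x := fun x hx => by
    obtain ⟨k, hk⟩ := hT x
    exact ⟨k, huniq k x hx hk⟩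
  have hinja := fun k l => injOn_compl_of_card_eq hsurj hmT hcard hab hmab (k := k) (l := l)
  have hinjb := fun k l => injOn_compl_of_card_eq hsurj hmT hcard hab.symm hmab.symm
    (k := k) (l := l)
  have hout' : ∀ a, ∃ y, ∀ k, k ≠ a → r k (m k) < r k y := fun a => by
    obtain ⟨y, hy⟩ := hout a
    refine ⟨y, fun k hk => ?_⟩
    obtain ⟨x, hx, hxy⟩ := hy k hk
    exact (hmin k x hx).trans_lt hxy
  have hcases : ∀ y, y ∉ T → Dominated r (insert y T) →
      (∀ k, k ≠ a → r k (m k) < r k y) ∨ (∀ k, k ≠ b → r k (m k) < r k y) := by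
    intro y hy hdom
    obtain ⟨p, hp⟩ := hdom y
    have hother : ∀ k, ∃ q, q ≠ p ∧ m q = m k ∧ r q (m q) < r q y := by
      intro k
      obtain ⟨q, hq⟩ := hdom (m k)
      have hqk : m q = m k :=
        huniq q _ (hmT k) fun z hz => hq z (Finset.mem_insert_of_mem hz)
      have hne : m k ≠ y := fun h => hy (h ▸ hmT k)
      have hlt : r q (m k) < r q y :=
        lt_of_le_of_ne (hq y (Finset.mem_insert_self _ _)) fun h => hne (hr q h)
      refine ⟨q, ?_, hqk, hqk ▸ hlt⟩
      rintro rfl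
      exact absurd (hp _ (Finset.mem_insert_of_mem (hmT k))) (not_le.2 hlt)
    by_cases hpa : p = a
    · subst hpa
      left
      intro k hk
      obtain ⟨q, hqp, hqk, hlt⟩ := hother k
      rwa [← hinja q k hqp hk hqk]
    · have hpb : p = b := by
        obtain ⟨q, hqp, hqk, -⟩ := hother p
        by_contra hpb
        by_cases hqa : q = a
        · exact hqp (hinjb q p (by rw [hqa]; exact hab) hpb hqk)
        · exact hqp (hinja q p hqa hpa hqk)
      subst hpb
      right
      intro k hk
      obtain ⟨q, hqp, hqk, hlt⟩ := hother k
      rwa [← hinjb q k hqp hk hqk]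
  obtain ⟨ya, hya, hda, hua⟩ := hT.exists_unique_pivot hr hmT hmin (hout' a)
  obtain ⟨yb, hyb, hdb, hub⟩ := hT.exists_unique_pivot hr hmT hmin (hout' b)
  have hyaT : ya ∉ T := fun h => by
    obtain ⟨k, hk⟩ := hsurj ya h
    by_cases hka : k = a
    · have := hya b hab.symm
      rw [← hmab, ← hka, hk] at this
      exact lt_irrefl _ this
    · have := hya k hka
      rw [hk] at this
      exact lt_irrefl _ this
  have hybT : yb ∉ T := fun h => by
    obtain ⟨k, hk⟩ := hsurj yb h
    by_cases hkb : k = b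
    · have := hyb a hab
      rw [hmab, ← hkb, hk] at this
      exact lt_irrefl _ this
    · have := hyb k hkb
      rw [hk] at this
      exact lt_irrefl _ this
  have hne : ya ≠ yb := by
    rintro rfl
    obtain ⟨p, hp⟩ := hT ya
    by_cases hpa : p = a
    · exact absurd (hp _ (hmT p)) (not_le.2 (hyb p (by rw [hpa]; exact hab)))
    · exact absurd (hp _ (hmT p)) (not_le.2 (hya p hpa))
  rw [Finset.card_eq_two]
  refine ⟨insert ya T, insert yb T, ?_, ?_⟩
  · intro h
    have : ya ∈ insert yb T := h ▸ Finset.mem_insert_self _ _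
    rcases Finset.mem_insert.1 this with h | h
    · exact hne h
    · exact hyaT h
  · ext S
    rw [hR, Finset.mem_insert, Finset.mem_singleton]
    constructor
    · rintro ⟨hTS, hSc, hSd⟩
      obtain ⟨y, hy, rfl⟩ : ∃ y, y ∉ T ∧ insert y T = S := by
        have : (S \ T).card = 1 := by
          rw [Finset.card_sdiff_of_subset hTS]; omega
        obtain ⟨y, hy⟩ := Finset.card_eq_one.1 this
        have hyS : y ∈ S \ T := hy ▸ Finset.mem_singleton_self y
        refine ⟨y, (Finset.mem_sdiff.1 hyS).2, ?_⟩
        rw [Finset.insert_eq, ← hy, Finset.sdiff_union_of_subset hTS]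
      rcases hcases y hy hSd with h | h
      · left; rw [hua y h hSd]
      · right; rw [hub y h hSd]
    · rintro (rfl | rfl)
      · exact ⟨Finset.subset_insert _ _, by rw [Finset.card_insert_of_notMem hyaT, hcard], hda⟩
      · exact ⟨Finset.subset_insert _ _, by rw [Finset.card_insert_of_notMem hybT, hcard], hdb⟩

/-- **Scarf's lemma** in the formulation with slack elements: if every element `e i` of a family
of slack elements is minimal in ranking `i` and above all proper elements in the other rankings,
then any colouring giving `e i` the colour `i` admits a dominated set showing all colours. -/
theorem exists_dominated_forall_color {I W : Type*} [Fintype I] [Nonempty I] [Fintype W]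
    {r : I → W → ℕ} (hr : ∀ i, Function.Injective (r i)) {e : I → W}
    (hmin : ∀ i w, r i (e i) ≤ r i w)
    (hmax : ∀ i j v, j ≠ i → v ∉ Set.range e → r i v < r i (e j))
    (hproper : ∃ v, v ∉ Set.range e) {c : W → I} (hc : ∀ i, c (e i) = i) :
    ∃ S : Finset W, Dominated r S ∧ ∀ i, ∃ x ∈ S, c x = i := by
  classical
  by_contra! hcon
  obtain ⟨i₀⟩ := ‹Nonempty I›
  have hIpos : 0 < Fintype.card I := Fintype.card_pos_iff.2 ⟨i₀⟩
  have heinj : Function.Injective e := fun i j h => by rw [← hc i, ← hc j, h]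
  have hebot : ∀ i v, r i v ≤ r i (e i) → v = e i := fun i v h =>
    hr i (le_antisymm h (hmin i v))
  set R : Finset (Finset W) :=
    Finset.univ.filter fun S => S.card = Fintype.card I ∧ Dominated r S with hRdef
  set D : Finset (Finset W) := Finset.univ.filter fun T =>
    T.card + 1 = Fintype.card I ∧ T.image c = Finset.univ.erase i₀ with hDdef
  have hR : ∀ S, S ∈ R ↔ S.card = Fintype.card I ∧ Dominated r S := fun S => by simp [hRdef]
  have hD : ∀ T, T ∈ D ↔ T.card + 1 = Fintype.card I ∧ T.image c = Finset.univ.erase i₀ :=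
    fun T => by simp [hDdef]
  have hcount := Finset.sum_card_bipartiteAbove_eq_sum_card_bipartiteBelow
    (s := D) (t := R) (r := fun T S => T ⊆ S)
  have hins : ∀ T S : Finset W, T.card + 1 = Fintype.card I → S.card = Fintype.card I → T ⊆ S →
      ∃ y, y ∉ T ∧ S = insert y T := by
    intro T S hT hS hTS
    have : (S \ T).card = 1 := by
      rw [Finset.card_sdiff_of_subset hTS]; omega
    obtain ⟨y, hy⟩ := Finset.card_eq_one.1 this
    have hyS : y ∈ S \ T := hy ▸ Finset.mem_singleton_self y
    refine ⟨y, (Finset.mem_sdiff.1 hyS).2, ?_⟩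
    rw [Finset.insert_eq, ← hy, Finset.sdiff_union_of_subset hTS]
  -- each room has an even number of doors
  have hright : ∀ S ∈ R, Even (D.bipartiteBelow (fun T S => T ⊆ S) S).card := by
    intro S hS
    rcases (D.bipartiteBelow (fun T S => T ⊆ S) S).eq_empty_or_nonempty with h | ⟨T, hT⟩
    · simp [h]
    obtain ⟨hTD, hTS⟩ := (Finset.mem_bipartiteBelow _).1 hT
    obtain ⟨hTc, hTi⟩ := (hD T).1 hTD
    obtain ⟨hSc, hSd⟩ := (hR S).1 hS
    obtain ⟨x, hx, rfl⟩ := hins T S hTc hSc hTS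
    have hTmem : ∀ i, i ≠ i₀ → ∃ t ∈ T, c t = i := fun i hi => by
      have : i ∈ T.image c := by rw [hTi]; simpa using hi
      simpa using this
    have hTne : ∀ t ∈ T, c t ≠ i₀ := fun t ht => by
      have : c t ∈ T.image c := Finset.mem_image_of_mem c ht
      rw [hTi] at this
      exact (Finset.mem_erase.1 this).1
    have hTinj : Set.InjOn c T := by
      rw [← Finset.card_image_iff, hTi, Finset.card_erase_of_mem (Finset.mem_univ _),
        Finset.card_univ]
      omega
    have hxc : c x ≠ i₀ := by
      intro hxc
      obtain ⟨i, hi⟩ := hcon _ hSd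
      by_cases h : i = i₀
      · exact hi x (Finset.mem_insert_self _ _) (by rw [hxc, h])
      · obtain ⟨t, ht, hti⟩ := hTmem i h
        exact hi t (Finset.mem_insert_of_mem ht) hti
    obtain ⟨x', hx', hcx'⟩ := hTmem _ hxc
    have hxx' : x ≠ x' := fun h => hx (h ▸ hx')
    have htwo : (D.bipartiteBelow (fun T S => T ⊆ S) (insert x T)).card = 2 := by
      rw [Finset.card_eq_two]
      refine ⟨T, (insert x T).erase x', ?_, ?_⟩
      · intro h
        rw [h] at hx'
        simp at hx'
      ext T'
      rw [Finset.mem_bipartiteBelow, Finset.mem_insert, Finset.mem_singleton]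
      constructor
      · rintro ⟨hTD', hTS'⟩
        obtain ⟨hTc', hTi'⟩ := (hD T').1 hTD'
        obtain ⟨z, hz, hzT⟩ := hins T' _ hTc' hSc hTS'
        have hT' : T' = (insert x T).erase z := by rw [hzT, Finset.erase_insert hz]
        have hzmem : z ∈ insert x T := by rw [hzT]; exact Finset.mem_insert_self _ _
        rcases Finset.mem_insert.1 hzmem with rfl | hzmem
        · left; rw [hT', Finset.erase_insert hx]
        right
        have : c z ∈ T'.image c := by
          rw [hTi']; simpa using hTne z hzmem
        obtain ⟨z', hz', hzz'⟩ := Finset.mem_image.1 this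
        have hne : z' ≠ z := fun h => hz (h ▸ hz')
        rcases Finset.mem_insert.1 (hTS' hz') with h | h
        · have : z = x' := hTinj hzmem hx' (by rw [hcx', ← hzz', h])
          rw [hT', this]
        · exact absurd (hTinj h hzmem hzz') hne
      · rintro (rfl | rfl)
        · exact ⟨hTD, hTS⟩
        refine ⟨(hD _).2 ⟨?_, ?_⟩, Finset.erase_subset _ _⟩
        · rw [Finset.card_erase_of_mem (Finset.mem_insert_of_mem hx'), hSc]; omega
        ext i
        simp only [Finset.mem_image, Finset.mem_erase, Finset.mem_univ, and_true]
        constructor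
        · rintro ⟨t, ⟨-, ht⟩, rfl⟩
          rcases Finset.mem_insert.1 ht with rfl | ht
          · exact hxc
          · exact hTne t ht
        · intro hi
          obtain ⟨t, ht, rfl⟩ := hTmem i hi
          by_cases htx : t = x'
          · exact ⟨x, ⟨hxx', Finset.mem_insert_self _ _⟩, by rw [htx, hcx']⟩
          · exact ⟨t, ⟨htx, Finset.mem_insert_of_mem ht⟩, rfl⟩
    rw [htwo]
    exact even_two
  set T₀ : Finset W := (Finset.univ.erase i₀).image e with hT₀def
  have hT₀ : ∀ i, i ≠ i₀ → e i ∈ T₀ := fun i hi => by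
    rw [hT₀def]; exact Finset.mem_image_of_mem e (by simpa using hi)
  have hT₀' : ∀ x ∈ T₀, ∃ i, i ≠ i₀ ∧ e i = x := fun x hx => by
    simpa [hT₀def] using hx
  have hT₀D : T₀ ∈ D := by
    rw [hD]
    constructor
    · rw [hT₀def, Finset.card_image_of_injective _ heinj,
        Finset.card_erase_of_mem (Finset.mem_univ _), Finset.card_univ]
      omega
    · rw [hT₀def, Finset.image_image, show c ∘ e = id from funext hc, Finset.image_id]
  have hleft : ∀ T ∈ D, T ≠ T₀ → Even (R.bipartiteAbove (fun T S => T ⊆ S) T).card := by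
    intro T hTD hTT
    obtain ⟨hTc, hTi⟩ := (hD T).1 hTD
    by_cases hTd : Dominated r T
    swap
    · have : R.bipartiteAbove (fun T S => T ⊆ S) T = ∅ := by
        rw [Finset.eq_empty_iff_forall_notMem]
        intro S hS
        obtain ⟨hSR, hTS⟩ := (Finset.mem_bipartiteAbove _).1 hS
        exact hTd (((hR S).1 hSR).2.mono hTS)
      simp [this]
    obtain ⟨v, hvT, hv⟩ : ∃ v ∈ T, v ∉ Set.range e := by
      by_contra! h
      apply hTT
      ext x
      constructor
      · intro hx
        obtain ⟨i, rfl⟩ := h x hx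
        apply hT₀
        rintro rfl
        have : c (e i) ∈ T.image c := Finset.mem_image_of_mem c hx
        rw [hTi, hc] at this
        simp at this
      · intro hx
        obtain ⟨i, hi, rfl⟩ := hT₀' x hx
        have : i ∈ T.image c := by rw [hTi]; simpa using hi
        obtain ⟨t, ht, hti⟩ := Finset.mem_image.1 this
        obtain ⟨j, rfl⟩ := h t ht
        rw [hc] at hti
        rwa [← hti]
    rw [hTd.card_rooms_eq_two hr ⟨v, hvT⟩ hTc (fun a => ⟨e a, fun k hk => ⟨v, hvT,
      hmax k a v hk.symm hv⟩⟩) _ (fun S => ?_)]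
    · exact even_two
    · rw [Finset.mem_bipartiteAbove, hR]; tauto
  have hone : (R.bipartiteAbove (fun T S => T ⊆ S) T₀).card = 1 := by
    obtain ⟨v₀, hv₀⟩ := hproper
    obtain ⟨v, hv, hvmax⟩ := Finset.exists_max_image
      (Finset.univ.filter fun v => v ∉ Set.range e) (r i₀) ⟨v₀, by simpa using hv₀⟩
    simp only [Finset.mem_filter, Finset.mem_univ, true_and] at hv hvmax
    have hvT : v ∉ T₀ := fun h => by
      obtain ⟨i, -, hi⟩ := hT₀' v h
      exact hv ⟨i, hi⟩
    rw [Finset.card_eq_one]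
    refine ⟨insert v T₀, ?_⟩
    ext S
    rw [Finset.mem_bipartiteAbove, hR, Finset.mem_singleton]
    constructor
    · rintro ⟨⟨hSc, hSd⟩, hTS⟩
      obtain ⟨y, hy, rfl⟩ := hins T₀ S ((hD _).1 hT₀D).1 hSc hTS
      obtain ⟨i, hi⟩ := hSd v
      have hii : i = i₀ := by
        by_contra hii
        exact hv ⟨i, (hebot i v (hi _ (Finset.mem_insert_of_mem (hT₀ i hii)))).symm⟩
      subst hii
      have hvy := hi y (Finset.mem_insert_self _ _)
      have hye : y ∉ Set.range e := by
        rintro ⟨j, rfl⟩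
        by_cases hj : j = i
        · subst hj
          exact hv ⟨j, (hebot j v hvy).symm⟩
        · exact hy (hT₀ j hj)
      rw [hr i (le_antisymm hvy (hvmax y hye))]
    · rintro rfl
      refine ⟨⟨?_, ?_⟩, Finset.subset_insert _ _⟩
      · rw [Finset.card_insert_of_notMem hvT, ((hD _).1 hT₀D).1]
      intro z
      by_cases hz : z ∈ Set.range e
      · obtain ⟨j, rfl⟩ := hz
        exact ⟨j, fun x _ => hmin j x⟩
      · refine ⟨i₀, fun x hx => ?_⟩
        rcases Finset.mem_insert.1 hx with rfl | hx
        · exact hvmax z hz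
        · obtain ⟨j, hj, rfl⟩ := hT₀' x hx
          exact (hmax i₀ j z hj hz).le
  rw [← Finset.add_sum_erase _ _ hT₀D, hone] at hcount
  have h1 : Even (∑ T ∈ D.erase T₀, (R.bipartiteAbove (fun T S => T ⊆ S) T).card) :=
    Finset.even_sum _ fun T hT => hleft T (Finset.mem_of_mem_erase hT) (Finset.ne_of_mem_erase hT)
  have h2 : Even (∑ S ∈ R, (D.bipartiteBelow (fun T S => T ⊆ S) S).card) :=
    Finset.even_sum _ hright
  rw [← hcount] at h2
  obtain ⟨p, hp⟩ := h1
  obtain ⟨q, hq⟩ := h2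
  omega

/-- A colouring of the grid points of a dilated simplex which gives `y` a colour whose coordinate
is not much larger than the smallest one admits a cluster of grid points of all colours. -/
theorem exists_rainbow_cluster {I : Type*} [Fintype I] [Nonempty I] {N : ℕ}
    (hN : 2 * Fintype.card I * Fintype.card I + 2 * Fintype.card I ≤ N) (c : (I → ℕ) → I)
    (hc : ∀ y : I → ℕ, ∑ i, y i = N →
      ∀ k, 2 * Fintype.card I * y (c y) ≤ 2 * Fintype.card I * y k + N) :
    ∃ x : I → I → ℕ, (∀ i, ∑ k, x i k = N) ∧ (∀ i, c (x i) = i) ∧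
      ∀ i j k, x i k ≤ x j k + Fintype.card I := by
  classical
  set n := Fintype.card I with hn
  have hnpos : 0 < n := Fintype.card_pos
  let V := {y : I → Fin (N + 1) // ∑ i, (y i : ℕ) = N}
  let K := Fintype.card V
  let enc : V ≃ Fin K := Fintype.equivFin V
  let enc' : I ≃ Fin n := Fintype.equivFin I
  let r : I → V ⊕ I → ℕ := fun i => Sum.elim (fun y => 1 + ((y.1 i : ℕ) * K + enc y))
    (fun j => if j = i then 0 else 1 + ((N + 1) * K + enc' j))
  have hlt : ∀ (i : I) (y : V), (y.1 i : ℕ) * K + enc y < (N + 1) * K := fun i y => by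
    have h1 : (y.1 i : ℕ) + 1 ≤ N + 1 := by have := (y.1 i).2; omega
    have h2 := (enc y).2
    have h3 := Nat.mul_le_mul_right K h1
    rw [add_mul, one_mul] at h3
    omega
  have hcoord : ∀ (i : I) (y z : V), r i (Sum.inl y) ≤ r i (Sum.inl z) →
      (y.1 i : ℕ) ≤ z.1 i := by
    intro i y z h
    by_contra! hlt
    have h3 := Nat.mul_le_mul_right K (Nat.succ_le_of_lt hlt)
    rw [Nat.succ_mul] at h3
    have h2 := (enc z).2
    simp only [r, Sum.elim_inl] at h
    omega
  have hr : ∀ i, Function.Injective (r i) := by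
    rintro i (y | j) (z | l) h
    · have h1 := le_antisymm (hcoord i y z h.le) (hcoord i z y h.ge)
      simp only [r, Sum.elim_inl, h1] at h
      rw [enc.injective (Fin.ext (by omega : (enc y : ℕ) = enc z))]
    · have := hlt i y
      simp only [r, Sum.elim_inl, Sum.elim_inr] at h
      split_ifs at h <;> omega
    · have := hlt i z
      simp only [r, Sum.elim_inl, Sum.elim_inr] at h
      split_ifs at h <;> omega
    · simp only [r, Sum.elim_inr] at h
      split_ifs at h with h1 h2 h2
      · rw [h1, h2]
      · omega
      · omega
      · rw [enc'.injective (Fin.ext (by omega : (enc' j : ℕ) = enc' l))]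
  have hmk : ∀ y : I → ℕ, ∑ i, y i = N → ∃ v : V, ∀ i, (v.1 i : ℕ) = y i := fun y hy =>
    ⟨⟨fun i => ⟨y i, Nat.lt_succ_of_le (hy ▸ Finset.single_le_sum (fun _ _ => Nat.zero_le _)
      (Finset.mem_univ i))⟩, by simpa using hy⟩, fun i => rfl⟩
  obtain ⟨v₀, -⟩ : ∃ v : V, True := by
    obtain ⟨i₀⟩ := ‹Nonempty I›
    obtain ⟨v, -⟩ := hmk (Pi.single i₀ N) (by simp)
    exact ⟨v, trivial⟩
  obtain ⟨S, hSd, hS⟩ := exists_dominated_forall_color hr (e := Sum.inr)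
    (fun i w => by simp [r])
    (fun i j v hj hv => by
      rcases v with y | l
      · have := hlt i y
        simp only [r, Sum.elim_inl, Sum.elim_inr, if_neg hj]
        omega
      · exact absurd ⟨l, rfl⟩ hv)
    ⟨Sum.inl v₀, by simp⟩ (c := Sum.elim (fun v => c fun i => v.1 i) id) (fun i => rfl)
  choose x hxS hx using hS
  set C : Finset I := Finset.univ.filter fun i => ∃ y, x i = Sum.inl y with hC
  have hxC : ∀ i, i ∉ C → x i = Sum.inr i := by
    intro i hi
    have hi' : ¬ ∃ y, x i = Sum.inl y := by simpa [hC] using hi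
    rcases hxi : x i with y | l
    · exact absurd ⟨y, hxi⟩ hi'
    · have := hx i
      rw [hxi] at this
      rw [← this]; rfl
  have hdomC : ∀ y : V, ∃ i ∈ C, ∀ z : V, Sum.inl z ∈ S → (y.1 i : ℕ) ≤ z.1 i := by
    intro y
    obtain ⟨i, hi⟩ := hSd (Sum.inl y)
    refine ⟨i, ?_, fun z hz => hcoord i y z (hi _ hz)⟩
    by_contra hiC
    have := hi _ (hxS i)
    rw [hxC i hiC] at this
    simp [r] at this
  set σ : Finset V := Finset.univ.filter fun z => Sum.inl z ∈ S with hσ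
  have hσmem : ∀ z, z ∈ σ ↔ Sum.inl z ∈ S := fun z => by simp [hσ]
  have hσne : σ.Nonempty := by
    obtain ⟨i, hi, -⟩ := hdomC v₀
    obtain ⟨y, hy⟩ : ∃ y, x i = Sum.inl y := by simpa [hC] using hi
    exact ⟨y, (hσmem y).2 (hy ▸ hxS i)⟩
  set m : I → ℕ := fun i => σ.inf' hσne fun z => (z.1 i : ℕ) with hm
  have hmle : ∀ z ∈ σ, ∀ i, m i ≤ z.1 i := fun z hz i =>
    Finset.inf'_le (fun z : V => (z.1 i : ℕ)) hz
  have hCsum : N < ∑ i ∈ C, (m i + 1) := by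
    by_contra! hle
    obtain ⟨i₁, hi₁, -⟩ := hdomC v₀
    obtain ⟨v, hv⟩ := hmk (fun i => (if i ∈ C then m i + 1 else 0) +
      if i = i₁ then N - ∑ i ∈ C, (m i + 1) else 0) (by
        rw [Finset.sum_add_distrib, ← Finset.sum_filter]
        simp
        omega)
    obtain ⟨i, hiC, hi⟩ := hdomC v
    have h1 : (v.1 i : ℕ) ≤ m i := by
      rw [hm]
      exact (Finset.le_inf'_iff hσne _).2 fun z hz => hi z ((hσmem z).1 hz)
    rw [hv, if_pos hiC] at h1
    omega
  have hCcard : C.card ≤ n := Finset.card_le_univ C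
  have hsplit : ∀ z ∈ σ, ∑ i ∈ C, ((z.1 i : ℕ) - m i) + ∑ i ∈ Cᶜ, (z.1 i : ℕ) < n := by
    intro z hz
    have h1 := z.2
    rw [← Finset.sum_add_sum_compl C] at h1
    have h2 : ∑ i ∈ C, (z.1 i : ℕ) = ∑ i ∈ C, ((z.1 i : ℕ) - m i) + ∑ i ∈ C, m i := by
      rw [← Finset.sum_add_distrib]
      exact Finset.sum_congr rfl fun i _ => by have := hmle z hz i; omega
    rw [Finset.sum_add_distrib, Finset.sum_const, smul_eq_mul, mul_one] at hCsum
    omega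
  have hin : ∀ z ∈ σ, ∀ i ∈ C, (z.1 i : ℕ) ≤ m i + n := by
    intro z hz i hi
    have h1 := hsplit z hz
    have h2 := Finset.single_le_sum (f := fun i => (z.1 i : ℕ) - m i)
      (fun _ _ => Nat.zero_le _) hi
    omega
  have hnotin : ∀ z ∈ σ, ∀ i, i ∉ C → (z.1 i : ℕ) ≤ n := by
    intro z hz i hi
    have h1 := hsplit z hz
    have h2 := Finset.single_le_sum (f := fun i => (z.1 i : ℕ))
      (fun _ _ => Nat.zero_le _) (Finset.mem_compl.2 hi)
    omega
  have hCall : ∀ i, i ∈ C := by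
    by_contra! h
    obtain ⟨i₀, hi₀⟩ := h
    have hbound : ∀ k ∈ C, 2 * n * (m k + 1) ≤ 2 * n * n + 2 * n + N := by
      intro k hk
      obtain ⟨y, hy⟩ : ∃ y, x k = Sum.inl y := by simpa [hC] using hk
      have hyσ : y ∈ σ := (hσmem y).2 (hy ▸ hxS k)
      have hck : (c fun i => y.1 i) = k := by have := hx k; rwa [hy] at this
      have h1 := hc (fun i => y.1 i) y.2 i₀
      rw [hck] at h1
      have h2 := Nat.mul_le_mul_left (2 * n) (hnotin y hyσ i₀ hi₀)
      have h3 := Nat.mul_le_mul_left (2 * n) (hmle y hyσ k)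
      rw [mul_add, mul_one]
      omega
    have h1 := Finset.sum_le_card_nsmul C _ _ hbound
    rw [← Finset.mul_sum, smul_eq_mul] at h1
    have h2 : C.card * (2 * n * n + 2 * n + N) ≤ n * (2 * N) :=
      Nat.mul_le_mul hCcard (by omega)
    nlinarith
  have hxl : ∀ i, ∃ y, x i = Sum.inl y := fun i => by simpa [hC] using hCall i
  choose y hy using hxl
  have hyσ : ∀ i, y i ∈ σ := fun i => (hσmem _).2 (hy i ▸ hxS i)
  refine ⟨fun i k => (y i).1 k, fun i => (y i).2, fun i => ?_, fun i j k => ?_⟩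
  · have := hx i
    rwa [hy] at this
  · exact (hin _ (hyσ i) k (hCall k)).trans (Nat.add_le_add_right (hmle _ (hyσ j) k) n)

/-- A covering theorem of Knaster–Kuratowski–Mazurkiewicz type: if every point `t` of the simplex
lies in some `C s` whose coordinate `t s` is not much larger than the smallest one, and the sets
`C s` are closed, then they have a common point. -/
theorem exists_mem_stdSimplex_forall_mem {I : Type*} [Fintype I] [Nonempty I]
    {C : I → Set (I → ℝ)} (hclosed : ∀ i, IsClosed (C i))
    (hcover : ∀ t ∈ stdSimplex ℝ I,
      ∃ s, t ∈ C s ∧ ∀ k, t s ≤ t k + 1 / (2 * Fintype.card I)) :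
    ∃ t ∈ stdSimplex ℝ I, ∀ i, t ∈ C i := by
  classical
  set n := Fintype.card I with hn
  have hnpos : 0 < n := Fintype.card_pos
  set N : ℕ → ℕ := fun p => 2 * n * n + 2 * n + p with hNdef
  have hNpos : ∀ p, (0 : ℝ) < N p := fun p => by
    have : 0 < N p := by rw [hNdef]; positivity
    exact_mod_cast this
  have hsimplex : ∀ p (y : I → ℕ), ∑ i, y i = N p →
      (fun i => (y i : ℝ) / N p) ∈ stdSimplex ℝ I := by
    intro p y hy
    refine ⟨fun i => by positivity, ?_⟩
    rw [← Finset.sum_div, div_eq_one_iff_eq (hNpos p).ne']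
    exact_mod_cast hy
  have hx : ∀ p, ∃ x : I → I → ℝ, (∀ i, x i ∈ stdSimplex ℝ I) ∧ (∀ i, x i ∈ C i) ∧
      ∀ i j k, x i k ≤ x j k + n / N p := by
    intro p
    have hc : ∀ y : I → ℕ, ∃ s, ∑ i, y i = N p → ((fun i => (y i : ℝ) / N p) ∈ C s ∧
        ∀ k, (y s : ℝ) / N p ≤ y k / N p + 1 / (2 * n)) := by
      intro y
      by_cases hy : ∑ i, y i = N p
      · obtain ⟨s, hs⟩ := hcover _ (hsimplex p y hy)
        exact ⟨s, fun _ => hs⟩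
      · exact ⟨Classical.arbitrary I, fun h => absurd h hy⟩
    choose c hc using hc
    obtain ⟨x, hx, hxc, hxx⟩ := exists_rainbow_cluster (N := N p) (by rw [hNdef]; simp [hn]) c
      (fun y hy k => by
        have h := (hc y hy).2 k
        have h1 := hNpos p
        have h2 : (0 : ℝ) < n := by exact_mod_cast hnpos
        rw [div_add_div _ _ h1.ne' (by positivity), div_le_div_iff₀ h1 (by positivity)] at h
        have h3 : (N p : ℝ) * (2 * n * y (c y)) ≤ N p * (2 * n * y k + N p) := by linarith
        have h4 := le_of_mul_le_mul_left h3 h1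
        rw [← hn]
        exact_mod_cast h4)
    refine ⟨fun i k => (x i k : ℝ) / N p, fun i => hsimplex p _ (hx i), fun i => ?_,
      fun i j k => ?_⟩
    · have := (hc (x i) (hx i)).1
      rwa [hxc] at this
    · rw [← add_div, div_le_div_iff_of_pos_right (hNpos p)]
      exact_mod_cast hxx i j k
  choose x hxs hxC hxx using hx
  obtain ⟨i₀⟩ := ‹Nonempty I›
  obtain ⟨t, ht, φ, hφ, hlim⟩ := (isCompact_stdSimplex ℝ I).tendsto_subseq fun p => hxs p i₀
  refine ⟨t, ht, fun i => (hclosed i).mem_of_tendsto (b := Filter.atTop)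
    (f := fun p => x (φ p) i) ?_
    (Filter.Eventually.of_forall fun p => hxC _ _)⟩
  rw [tendsto_pi_nhds] at hlim ⊢
  intro k
  have herr : Filter.Tendsto (fun p => (n : ℝ) / N (φ p)) Filter.atTop (nhds 0) := by
    apply Filter.Tendsto.const_div_atTop
    apply tendsto_natCast_atTop_atTop.comp
    refine Filter.tendsto_atTop_mono (fun p => ?_) hφ.tendsto_atTop
    rw [hNdef]
    exact Nat.le_add_left _ _
  have h1 : Filter.Tendsto (fun p => x (φ p) i₀ k - n / N (φ p)) Filter.atTop (nhds (t k)) := by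
    simpa using (hlim k).sub herr
  have h2 : Filter.Tendsto (fun p => x (φ p) i₀ k + n / N (φ p)) Filter.atTop (nhds (t k)) := by
    simpa using (hlim k).add herr
  refine tendsto_of_tendsto_of_tendsto_of_le_of_le h1 h2 (fun p => ?_) (fun p => ?_)
  · have := hxx (φ p) i₀ i k
    simp only
    linarith
  · exact hxx (φ p) i i₀ k

theorem exists_finset_bijOn_self {α : Type*} [Finite α] [Nonempty α] (g : α → α) :
    ∃ P : Finset α, P.Nonempty ∧ Set.BijOn g P P := by
  classical
  have := Fintype.ofFinite α
  refine ⟨(Function.periodicPts g).toFinset, ?_, by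
    simpa using Function.bijOn_periodicPts (f := g)⟩
  obtain ⟨x⟩ := ‹Nonempty α›
  obtain ⟨p, q, hne, heq⟩ := Finite.exists_ne_map_eq_of_infinite fun p : ℕ => g^[p] x
  wlog hpq : p < q generalizing p q
  · exact this q p hne.symm heq.symm (by omega)
  refine ⟨g^[p] x, ?_⟩
  rw [Set.mem_toFinset]
  refine Function.mk_mem_periodicPts (n := q - p) (by omega) ?_
  change g^[q - p] (g^[p] x) = g^[p] x
  rw [← Function.iterate_add_apply, Nat.sub_add_cancel hpq.le]
  exact heq.symm

theorem isFeasible_iff {n m k : ℕ} {cat : Fin m → Fin k} {s : Fin k → ℕ} {A : Fin m → Fin n} :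
    IsFeasible cat s A ↔
      ∀ i h, (Finset.univ.filter fun j => A j = i ∧ cat j = h).card ≤ s h := by
  simp only [IsFeasible, bundle, Finset.filter_filter]

theorem exists_isFeasible {n m k : ℕ} (cat : Fin m → Fin k) (s : Fin k → ℕ)
    (hcap : ∀ h : Fin k, (Finset.univ.filter (fun j => cat j = h)).card ≤ n * s h) :
    ∃ A : Fin m → Fin n, IsFeasible cat s A := by
  classical
  let idx : Fin m → ℕ := fun j => (Finset.univ.filter fun j' => j' < j ∧ cat j' = cat j).card
  have hidx : ∀ j, idx j < n * s (cat j) := fun j => by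
    refine lt_of_lt_of_le (Finset.card_lt_card ?_) (hcap (cat j))
    rw [Finset.ssubset_iff_of_subset
      (fun x hx => by simp only [Finset.mem_filter] at hx ⊢; exact ⟨hx.1, hx.2.2⟩)]
    exact ⟨j, by simp, by simp⟩
  have hmono : ∀ j j', cat j = cat j' → j < j' → idx j < idx j' := by
    intro j j' hc hlt
    refine Finset.card_lt_card ?_
    rw [Finset.ssubset_iff_of_subset (fun x hx => by
      simp only [Finset.mem_filter, Finset.mem_univ, true_and] at hx ⊢
      exact ⟨hx.1.trans hlt, hx.2.trans hc⟩)]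
    exact ⟨j, by simp [hlt, hc], by simp⟩
  refine ⟨fun j => ⟨idx j / s (cat j), Nat.div_lt_of_lt_mul (by rw [mul_comm]; exact hidx j)⟩, ?_⟩
  rw [isFeasible_iff]
  intro i h
  have hcard : (Finset.Ico (i * s h) (i * s h + s h)).card = s h := by simp
  refine le_of_le_of_eq (Finset.card_le_card_of_injOn idx ?_ ?_) hcard
  · intro j hj
    simp only [Finset.coe_filter, Finset.mem_univ, true_and, Set.mem_ofPred_eq] at hj
    obtain ⟨hj1, rfl⟩ := hj
    have hs : 0 < s (cat j) := by
      by_contra! h0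
      have h1 := hidx j
      rw [Nat.le_zero.1 h0] at h1
      simp at h1
    rw [Finset.coe_Ico, Set.mem_Ico, ← hj1]
    have h1 := Nat.div_add_mod (idx j) (s (cat j))
    have h2 := Nat.mod_lt (idx j) hs
    rw [mul_comm] at h1
    change idx j / s (cat j) * s (cat j) ≤ idx j ∧
      idx j < idx j / s (cat j) * s (cat j) + s (cat j)
    omega
  · intro j hj j' hj' heq
    simp only [Finset.coe_filter, Finset.mem_univ, true_and, Set.mem_ofPred_eq] at hj hj'
    have hc : cat j = cat j' := hj.2.trans hj'.2.symm
    rcases lt_trichotomy j j' with hlt | h | hlt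
    · have := hmono j j' hc hlt; omega
    · exact h
    · have := hmono j' j hc.symm hlt; omega

theorem card_filter_piecewise_add {α β : Type*} [Fintype α] [DecidableEq α] [DecidableEq β]
    (D : Finset α) (A B : α → β) (p : α → Prop) [DecidablePred p] (hD : ∀ j ∈ D, p j) (i : β) :
    (Finset.univ.filter fun j => D.piecewise B A j = i ∧ p j).card +
        (D.filter fun j => A j = i).card =
      (Finset.univ.filter fun j => A j = i ∧ p j).card + (D.filter fun j => B j = i).card := by
  have key : ∀ C : α → β, (Finset.univ.filter fun j => C j = i ∧ p j).card =
      (D.filter fun j => C j = i).card + (Dᶜ.filter fun j => C j = i ∧ p j).card := by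
    intro C
    rw [← Finset.card_union_of_disjoint]
    · congr 1
      ext j
      simp only [Finset.mem_filter, Finset.mem_univ, true_and, Finset.mem_union,
        Finset.mem_compl]
      have := hD j
      tauto
    · exact Finset.disjoint_filter_filter (disjoint_compl_right)
  rw [key, key A]
  have h1 : (D.filter fun j => D.piecewise B A j = i) = D.filter fun j => B j = i :=
    Finset.filter_congr fun j hj => by rw [Finset.piecewise_eq_of_mem _ _ _ hj]
  have h2 : (Dᶜ.filter fun j => D.piecewise B A j = i ∧ p j) =
      Dᶜ.filter fun j => A j = i ∧ p j :=
    Finset.filter_congr fun j hj => by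
      rw [Finset.piecewise_eq_of_notMem _ _ _ (Finset.mem_compl.1 hj)]
  rw [h1, h2]
  omega

/-- Two distinct feasible allocations can be brought closer to each other by exchanging at most one
item per agent between them, keeping both feasible. -/
theorem exists_exchange {n m k : ℕ} {cat : Fin m → Fin k} {s : Fin k → ℕ} {A B : Fin m → Fin n}
    (hA : IsFeasible cat s A) (hB : IsFeasible cat s B) {j₀ : Fin m} (hj₀ : A j₀ ≠ B j₀) :
    ∃ D : Finset (Fin m), D.Nonempty ∧ D.card ≤ n ∧ (∀ j ∈ D, A j ≠ B j) ∧
      IsFeasible cat s (D.piecewise B A) ∧ IsFeasible cat s (D.piecewise A B) := by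
  classical
  rw [isFeasible_iff] at hA hB
  set h := cat j₀ with hh
  set a : Fin n → ℕ := fun i => (Finset.univ.filter fun j => A j = i ∧ cat j = h).card with ha
  set b : Fin n → ℕ := fun i => (Finset.univ.filter fun j => B j = i ∧ cat j = h).card with hb
  let out : Fin n → Prop := fun i => ∃ j, A j = i ∧ cat j = h ∧ A j ≠ B j
  have hout₀ : out (A j₀) := ⟨j₀, rfl, rfl, hj₀⟩
  have hle : ∀ i, ¬ out i → a i ≤ b i := by
    intro i hi
    refine Finset.card_le_card fun j hj => ?_
    simp only [Finset.mem_filter, Finset.mem_univ, true_and] at hj ⊢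
    refine ⟨?_, hj.2⟩
    by_contra hne
    exact hi ⟨j, hj.1, hj.2, fun h => hne (h ▸ hj.1)⟩
  have hlt : ∀ i, ¬ out i → (∃ j, B j = i ∧ cat j = h ∧ A j ≠ B j) → a i < b i := by
    rintro i hi ⟨j, hj, hjc, hjn⟩
    refine Finset.card_lt_card ((Finset.ssubset_iff_of_subset fun j hj => ?_).2 ⟨j, ?_, ?_⟩)
    · simp only [Finset.mem_filter, Finset.mem_univ, true_and] at hj ⊢
      refine ⟨?_, hj.2⟩
      by_contra hne
      exact hi ⟨j, hj.1, hj.2, fun h => hne (h ▸ hj.1)⟩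
    · simp [hj, hjc]
    · simp only [Finset.mem_filter, Finset.mem_univ, true_and]
      rintro ⟨hAj, -⟩
      exact hjn (hAj.trans hj.symm)
  have hsum : ∑ i, a i = ∑ i, b i := by
    have key : ∀ C : Fin m → Fin n,
        ∑ i, (Finset.univ.filter fun j => C j = i ∧ cat j = h).card =
          (Finset.univ.filter fun j => cat j = h).card := by
      intro C
      rw [Finset.card_eq_sum_card_fiberwise (f := C) (t := Finset.univ) (by simp)]
      refine Finset.sum_congr rfl fun i _ => ?_
      rw [Finset.filter_filter]
      simp only [and_comm]
    rw [ha, hb]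
    simp only [key]
  obtain ⟨i₀, hi₀, hi₀b⟩ : ∃ i₀, out i₀ ∧ (b i₀ < s h ∨ ∀ i, out i → s h ≤ b i) := by
    by_cases hex : ∃ i₀, out i₀ ∧ b i₀ < s h
    · obtain ⟨i₀, h1, h2⟩ := hex
      exact ⟨i₀, h1, Or.inl h2⟩
    · push Not at hex
      exact ⟨_, hout₀, Or.inr hex⟩
  have he : ∀ i, ∃ j, out i → A j = i ∧ cat j = h ∧ A j ≠ B j := by
    intro i
    by_cases hi : out i
    · obtain ⟨j, hj⟩ := hi
      exact ⟨j, fun _ => hj⟩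
    · exact ⟨j₀, fun h => absurd h hi⟩
  choose e he using he
  let g : Fin n → Fin n := fun i => if out i then B (e i) else i₀
  have hg : ∀ i, out i → g i = B (e i) := fun i hi => if_pos hi
  have hg' : ∀ i, ¬ out i → g i = i₀ := fun i hi => if_neg hi
  have : Nonempty (Fin n) := ⟨i₀⟩
  obtain ⟨P, hPne, hPmaps, hPinj, hPsurj⟩ := exists_finset_bijOn_self g
  set D : Finset (Fin m) := (P.filter out).image e with hD
  have hDmem : ∀ j, j ∈ D ↔ ∃ i ∈ P, out i ∧ e i = j := by
    intro j
    simp [hD, and_assoc]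
  have hDcat : ∀ j ∈ D, cat j = h := by
    intro j hj
    obtain ⟨i, -, hi, rfl⟩ := (hDmem j).1 hj
    exact (he i hi).2.1
  have hDA : ∀ i, i ∈ P → out i → 0 < (D.filter fun j => A j = i).card := fun i hi hio =>
    Finset.card_pos.2 ⟨e i, Finset.mem_filter.2 ⟨(hDmem _).2 ⟨i, hi, hio, rfl⟩, (he i hio).1⟩⟩
  have hDB : ∀ i, i ∈ P → out i → 0 < (D.filter fun j => B j = g i).card := fun i hi hio =>
    Finset.card_pos.2 ⟨e i, Finset.mem_filter.2
      ⟨(hDmem _).2 ⟨i, hi, hio, rfl⟩, (hg i hio).symm⟩⟩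
  have hDA1 : ∀ i, (D.filter fun j => A j = i).card ≤ 1 := by
    intro i
    rw [Finset.card_le_one]
    intro x hx y hy
    rw [Finset.mem_filter, hDmem] at hx hy
    obtain ⟨⟨p, hpP, hp, rfl⟩, hpi⟩ := hx
    obtain ⟨⟨q, hqP, hq, rfl⟩, hqi⟩ := hy
    rw [(he p hp).1] at hpi
    rw [(he q hq).1] at hqi
    rw [hpi, hqi]
  have hDB1 : ∀ i, (D.filter fun j => B j = i).card ≤ 1 := by
    intro i
    rw [Finset.card_le_one]
    intro x hx y hy
    rw [Finset.mem_filter, hDmem] at hx hy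
    obtain ⟨⟨p, hpP, hp, rfl⟩, hpi⟩ := hx
    obtain ⟨⟨q, hqP, hq, rfl⟩, hqi⟩ := hy
    rw [← hg p hp] at hpi
    rw [← hg q hq] at hqi
    rw [hPinj hpP hqP (hpi.trans hqi.symm)]
  have hgain : ∀ i, a i + (D.filter fun j => B j = i).card ≤
      s h + (D.filter fun j => A j = i).card := by
    intro i
    rcases (D.filter fun j => B j = i).eq_empty_or_nonempty with hem | ⟨j, hj⟩
    · rw [hem]
      exact (hA i h).trans (Nat.le_add_right _ _)
    rw [Finset.mem_filter, hDmem] at hj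
    obtain ⟨⟨p, hpP, hp, rfl⟩, hpi⟩ := hj
    have hiP : i ∈ P := by
      rw [← hpi, ← hg p hp]
      exact hPmaps hpP
    have h1 := hDB1 i
    by_cases hi : out i
    · have h2 := hDA i hiP hi
      have h3 : a i ≤ s h := hA i h
      omega
    · have h2 := hlt i hi ⟨e p, hpi, (he p hp).2⟩
      have h3 : b i ≤ s h := hB i h
      omega
  have hloss : ∀ i, b i + (D.filter fun j => A j = i).card ≤
      s h + (D.filter fun j => B j = i).card := by
    intro i
    rcases (D.filter fun j => A j = i).eq_empty_or_nonempty with hem | ⟨j, hj⟩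
    · rw [hem]
      exact (hB i h).trans (Nat.le_add_right _ _)
    rw [Finset.mem_filter, hDmem] at hj
    obtain ⟨⟨q, hqP, hq, rfl⟩, hqi⟩ := hj
    rw [(he q hq).1] at hqi
    subst hqi
    obtain ⟨p, hpP, hpq⟩ := hPsurj hqP
    have h1 := hDA1 q
    have h3 : b q ≤ s h := hB q h
    by_cases hp : out p
    · have h2 := hDB p hpP hp
      rw [hpq] at h2
      omega
    · have hq₀ : i₀ = q := (hg' p hp).symm.trans hpq
      subst hq₀
      rcases hi₀b with hlt' | hall
      · omega
      · exfalso
        obtain ⟨p', hp'P, hp'⟩ := hPsurj hpP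
        have hp'o : out p' := by
          by_contra hno
          rw [hg' p' hno] at hp'
          exact hp (hp' ▸ hq)
        rw [hg p' hp'o] at hp'
        have hstrict := hlt p hp ⟨e p', hp', (he p' hp'o).2⟩
        have : ∑ i, a i < ∑ i, b i := by
          refine Finset.sum_lt_sum (fun i _ => ?_) ⟨p, Finset.mem_univ _, hstrict⟩
          by_cases hi : out i
          · exact (hA i h).trans (hall i hi)
          · exact hle i hi
        omega
  have hoff : ∀ (C C' : Fin m → Fin n) (i : Fin n) (h' : Fin k), h' ≠ h →
      (Finset.univ.filter fun j => D.piecewise C C' j = i ∧ cat j = h') =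
        Finset.univ.filter fun j => C' j = i ∧ cat j = h' := by
    intro C C' i h' hne
    refine Finset.filter_congr fun j _ => and_congr_left fun hj => ?_
    rw [Finset.piecewise_eq_of_notMem _ _ _ fun hjD => hne (hj.symm.trans (hDcat j hjD))]
  refine ⟨D, ?_, ?_, ?_, ?_, ?_⟩
  · obtain ⟨p, hp⟩ := hPne
    by_cases hpo : out p
    · exact ⟨e p, (hDmem _).2 ⟨p, hp, hpo, rfl⟩⟩
    · have : i₀ ∈ P := by
        rw [← hg' p hpo]
        exact hPmaps hp
      exact ⟨e i₀, (hDmem _).2 ⟨i₀, this, hi₀, rfl⟩⟩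
  · refine Finset.card_image_le.trans ((Finset.card_le_univ _).trans ?_)
    simp
  · intro j hj
    obtain ⟨i, -, hi, rfl⟩ := (hDmem j).1 hj
    exact (he i hi).2.2
  · rw [isFeasible_iff]
    intro i h'
    by_cases hh' : h' = h
    · subst hh'
      have h1 := card_filter_piecewise_add D A B (fun j => cat j = h) hDcat i
      have h2 := hgain i
      simp only [ha] at h2
      omega
    · rw [hoff _ _ i h' hh']
      exact hA i h'
  · rw [isFeasible_iff]
    intro i h'
    by_cases hh' : h' = h
    · subst hh'
      have h1 := card_filter_piecewise_add D B A (fun j => cat j = h) hDcat i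
      have h2 := hloss i
      simp only [hb] at h2
      omega
    · rw [hoff _ _ i h' hh']
      exact hB i h'

/-- A feasible allocation is optimal for real values `v` if it maximizes the total value. -/
def IsOptimal {n m k : ℕ} (cat : Fin m → Fin k) (s : Fin k → ℕ) (v : Fin n → Fin m → ℝ)
    (A : Fin m → Fin n) : Prop :=
  IsFeasible cat s A ∧ ∀ B, IsFeasible cat s B → ∑ j, v (B j) j ≤ ∑ j, v (A j) j

theorem exists_isOptimal {n m k : ℕ} {cat : Fin m → Fin k} {s : Fin k → ℕ}
    (hcap : ∀ h : Fin k, (Finset.univ.filter (fun j => cat j = h)).card ≤ n * s h)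
    (v : Fin n → Fin m → ℝ) : ∃ A, IsOptimal cat s v A :=
  Set.exists_max_image {A | IsFeasible cat s A} (fun A => ∑ j, v (A j) j) (Set.toFinite _)
    (exists_isFeasible cat s hcap)

theorem IsOptimal.sum_eq {n m k : ℕ} {cat : Fin m → Fin k} {s : Fin k → ℕ}
    {v : Fin n → Fin m → ℝ} {A B : Fin m → Fin n} (hA : IsOptimal cat s v A)
    (hB : IsOptimal cat s v B) : ∑ j, v (A j) j = ∑ j, v (B j) j :=
  le_antisymm (hB.2 A hA.1) (hA.2 B hB.1)

/-- If two optimal allocations differ at an item, then some optimal allocation differs from the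
first one at this item and at no more than `n` items in total. -/
theorem IsOptimal.exists_ne_card_le {n m k : ℕ} {cat : Fin m → Fin k} {s : Fin k → ℕ}
    {v : Fin n → Fin m → ℝ} {A B : Fin m → Fin n} (hA : IsOptimal cat s v A)
    (hB : IsOptimal cat s v B) {j₀ : Fin m} (hj₀ : B j₀ ≠ A j₀) :
    ∃ B', IsOptimal cat s v B' ∧ B' j₀ ≠ A j₀ ∧
      (Finset.univ.filter fun j => B' j ≠ A j).card ≤ n := by
  classical
  induction hN : (Finset.univ.filter fun j => B j ≠ A j).card using Nat.strong_induction_on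
    generalizing B with
  | _ N ih =>
  obtain ⟨D, hDne, hDn, hDd, hC, hC'⟩ := exists_exchange hA.1 hB.1 hj₀.symm
  have hsum : ∑ j, v (D.piecewise B A j) j + ∑ j, v (D.piecewise A B j) j =
      ∑ j, v (A j) j + ∑ j, v (B j) j := by
    rw [← Finset.sum_add_distrib, ← Finset.sum_add_distrib]
    refine Finset.sum_congr rfl fun j _ => ?_
    by_cases hj : j ∈ D
    · simp [hj, add_comm]
    · simp [hj]
  have h1 := hA.2 _ hC
  have h2 := hA.2 _ hC'
  have h3 := hA.sum_eq hB
  by_cases hj : j₀ ∈ D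
  · refine ⟨D.piecewise B A, ⟨hC, fun E hE => (hA.2 E hE).trans (by linarith)⟩, by simpa [hj],
      (Finset.card_le_card fun j => ?_).trans hDn⟩
    by_cases hjD : j ∈ D <;> simp [hjD]
  · refine ih _ ?_ ⟨hC', fun E hE => (hA.2 E hE).trans (by linarith)⟩ (by simpa [hj]) rfl
    rw [← hN]
    obtain ⟨d, hd⟩ := hDne
    refine Finset.card_lt_card ((Finset.ssubset_iff_of_subset fun j => ?_).2 ⟨d, ?_, ?_⟩)
    · by_cases hjD : j ∈ D <;> simp [hjD]
    · simpa using (hDd d hd).symm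
    · simp [hd]

/-- If the perturbation `η` is linearly independent over `ℚ`, even together with `1`, and the weight
of agent `i₀` is `1`, then the optimal allocations differ from each other only in
`n * (n - 1)` items. -/
theorem IsOptimal.card_filter_exists_ne_le {n m k : ℕ} {cat : Fin m → Fin k} {s : Fin k → ℕ}
    {u : Fin n → Fin m → ℤ} {η : Fin n → Fin m → ℝ} {w : Fin n → ℝ} {i₀ : Fin n} (hi₀ : w i₀ = 1)
    (hη : ∀ (z : Fin n → Fin m → ℚ) (q : ℚ), (q : ℝ) + ∑ i, ∑ j, z i j * η i j = 0 → z = 0)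
    {A : Fin m → Fin n} (hA : IsOptimal cat s (fun i j => w i * u i j + η i j) A)
    {T : Finset (Fin m)}
    (hT : ∀ j ∈ T, ∃ B, IsOptimal cat s (fun i j => w i * u i j + η i j) B ∧ B j ≠ A j) :
    T.card ≤ n * (n - 1) := by
  classical
  set v : Fin n → Fin m → ℝ := fun i j => w i * u i j + η i j with hv
  let χ : (Fin m → Fin n) → Fin n → Fin m → ℚ := fun B i j => if B j = i then 1 else 0
  let Z : Set (Fin n → Fin m → ℚ) := {z | ∃ B, IsOptimal cat s v B ∧
    (Finset.univ.filter fun j => B j ≠ A j).card ≤ n ∧ z = χ B - χ A}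
  obtain ⟨b, hbZ, hspan, hli⟩ := exists_linearIndependent ℚ Z
  have hχ : ∀ B, ∑ i, ∑ j, (χ B i j : ℝ) * v i j = ∑ j, v (B j) j := by
    intro B
    rw [Finset.sum_comm]
    refine Finset.sum_congr rfl fun j _ => ?_
    simp [χ, apply_ite (Rat.cast (K := ℝ))]
  have hzero : ∀ z ∈ Submodule.span ℚ Z, ∑ i, ∑ j, (z i j : ℝ) * v i j = 0 := by
    intro z hz
    induction hz using Submodule.span_induction with
    | mem z hz =>
      obtain ⟨B, hB, -, rfl⟩ := hz
      have h1 := hχ B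
      have h2 := hχ A
      have h3 := hA.sum_eq hB
      simp only [Pi.sub_apply, Rat.cast_sub, sub_mul, Finset.sum_sub_distrib]
      linarith
    | zero => simp
    | add x y _ _ hx hy =>
      simp only [Pi.add_apply, Rat.cast_add, add_mul, Finset.sum_add_distrib, hx, hy, add_zero]
    | smul c x _ hx =>
      simp only [Pi.smul_apply, smul_eq_mul, Rat.cast_mul, mul_assoc, ← Finset.mul_sum, hx,
        mul_zero]
  let Ψ : (Fin n → Fin m → ℚ) →ₗ[ℚ] ({i // i ≠ i₀} → ℚ) :=
    { toFun := fun z i => ∑ j, z i j * u i j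
      map_add' := fun x y => by
        ext i
        simp [add_mul, Finset.sum_add_distrib]
      map_smul' := fun c x => by
        ext i
        simp [mul_assoc, Finset.mul_sum] }
  have hΨ : ∀ z ∈ Submodule.span ℚ Z, Ψ z = 0 → z = 0 := by
    intro z hz hΨz
    refine hη z (∑ j, z i₀ j * u i₀ j) ?_
    rw [← hzero z hz]
    simp only [hv, mul_add, Finset.sum_add_distrib]
    congr 1
    rw [Finset.sum_eq_single i₀]
    · simp [hi₀]
    · intro i _ hi
      have h1 : ∑ j, z i j * u i j = 0 := congrFun hΨz ⟨i, hi⟩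
      have h2 : ∑ j, (z i j : ℝ) * u i j = 0 := by exact_mod_cast h1
      calc ∑ j, (z i j : ℝ) * (w i * u i j) = w i * ∑ j, (z i j : ℝ) * u i j := by
            rw [Finset.mul_sum]
            exact Finset.sum_congr rfl fun j _ => by ring
        _ = 0 := by rw [h2, mul_zero]
    · simp
  have hbli : LinearIndependent ℚ (Ψ ∘ ((↑) : b → Fin n → Fin m → ℚ)) := by
    refine hli.map ?_
    rw [Subtype.range_coe, Submodule.disjoint_def, hspan]
    exact fun z hz hz0 => hΨ z hz (LinearMap.mem_ker.1 hz0)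
  have hbfin : b.Finite := by
    have : Finite b := hli.finite
    exact Set.toFinite b
  have := hbfin.fintype
  have hbcard : Fintype.card b ≤ n - 1 := by
    refine hbli.fintype_card_le_finrank.trans ?_
    simp [Fintype.card_subtype_compl]
  have hTsub : T ⊆ Finset.univ.biUnion fun z : b =>
      Finset.univ.filter fun j => ∃ i, (z : Fin n → Fin m → ℚ) i j ≠ 0 := by
    intro j hj
    obtain ⟨B, hB, hBj⟩ := hT j hj
    obtain ⟨B', hB', hB'j, hB'n⟩ := hA.exists_ne_card_le hB hBj
    by_contra hno
    simp only [Finset.mem_biUnion, Finset.mem_univ, true_and, Finset.mem_filter, not_exists,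
      not_not] at hno
    have hall : ∀ z ∈ Submodule.span ℚ Z, ∀ i, z i j = 0 := by
      rw [← hspan]
      intro z hz
      induction hz using Submodule.span_induction with
      | mem z hz => exact hno ⟨z, hz⟩
      | zero => simp
      | add x y _ _ hx hy => simp [hx, hy]
      | smul c x _ hx => simp [hx]
    have := hall _ (Submodule.subset_span ⟨B', hB', hB'n, rfl⟩) (A j)
    simp [χ, hB'j] at this
  calc T.card ≤ _ := Finset.card_le_card hTsub
    _ ≤ Fintype.card b * n := by
      refine Finset.card_biUnion_le_card_mul _ _ _ fun z _ => ?_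
      obtain ⟨B, -, hBn, hz⟩ := hbZ z.2
      refine (Finset.card_le_card fun j => ?_).trans hBn
      simp only [Finset.mem_filter, Finset.mem_univ, true_and, hz]
      rintro ⟨i, hi⟩ heq
      simp [χ, heq] at hi
    _ ≤ n * (n - 1) := by
      rw [mul_comm]
      exact Nat.mul_le_mul_left n hbcard

theorem sum_weighted_add_eq {n m : ℕ} (u : Fin n → Fin m → ℤ) (η : Fin n → Fin m → ℝ)
    (w : Fin n → ℝ) (A : Fin m → Fin n) :
    ∑ j, (w (A j) * u (A j) j + η (A j) j) =
      ∑ i, w i * (util u A i i : ℝ) + ∑ j, η (A j) j := by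
  rw [Finset.sum_add_distrib, ← Finset.sum_fiberwise Finset.univ A]
  congr 1
  refine Finset.sum_congr rfl fun i _ => ?_
  rw [util, bundle, Int.cast_sum, Finset.mul_sum]
  refine Finset.sum_congr rfl fun j hj => ?_
  rw [(Finset.mem_filter.1 hj).2]

theorem IsOptimal.isParetoOptimal {n m k : ℕ} {cat : Fin m → Fin k} {s : Fin k → ℕ}
    {u : Fin n → Fin m → ℤ} {η : Fin n → Fin m → ℝ} {w : Fin n → ℝ} {δ : ℝ} (hδ : 0 < δ)
    (hw : ∀ i, δ ≤ w i) (hη₀ : ∀ A : Fin m → Fin n, 0 ≤ ∑ j, η (A j) j)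
    (hηδ : ∀ A : Fin m → Fin n, ∑ j, η (A j) j < δ)
    {A : Fin m → Fin n} (hA : IsOptimal cat s (fun i j => w i * u i j + η i j) A) :
    IsParetoOptimal u cat s A := by
  refine ⟨hA.1, ?_⟩
  rintro ⟨B, hB, hle, i, hi⟩
  have h1 := hA.2 B hB
  simp only [sum_weighted_add_eq] at h1
  have h2 : ∑ i, w i * ((util u B i i : ℝ) - util u A i i) < δ := by
    simp only [mul_sub, Finset.sum_sub_distrib]
    linarith [hη₀ B, hηδ A]
  refine h2.not_ge ?_
  have h3 : (1 : ℝ) ≤ (util u B i i : ℝ) - util u A i i := by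
    exact_mod_cast (show (1 : ℤ) ≤ util u B i i - util u A i i by omega)
  calc δ ≤ w i * 1 := by rw [mul_one]; exact hw i
    _ ≤ w i * ((util u B i i : ℝ) - util u A i i) :=
      mul_le_mul_of_nonneg_left h3 (hδ.le.trans (hw i))
    _ ≤ _ := Finset.single_le_sum (f := fun i => w i * ((util u B i i : ℝ) - util u A i i))
      (fun i _ => mul_nonneg (hδ.le.trans (hw i)) (sub_nonneg.2 (by exact_mod_cast hle i)))
      (Finset.mem_univ i)

/-- Permuting the bundles of an optimal allocation along a cycle of envy does not increase its
value. So some agent is not envious, and her weight is not much smaller than the largest one. -/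
theorem IsOptimal.exists_envyFreeFor {n m k : ℕ} {cat : Fin m → Fin k} {s : Fin k → ℕ}
    {u : Fin n → Fin m → ℤ} {η : Fin n → Fin m → ℝ} {w : Fin n → ℝ} {δ M : ℝ} (hδ : 0 < δ)
    (hw : ∀ i, δ ≤ w i) (hη₀ : ∀ A : Fin m → Fin n, 0 ≤ ∑ j, η (A j) j)
    (hηδ : ∀ A : Fin m → Fin n, ∑ j, η (A j) j < δ) {i₀ : Fin n} (hi₀ : w i₀ = 1) (hM : 1 ≤ M)
    (huM : ∀ (A : Fin m → Fin n) (i i' : Fin n), (util u A i i : ℝ) - util u A i i' ≤ M)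
    {A : Fin m → Fin n} (hA : IsOptimal cat s (fun i j => w i * u i j + η i j) A) :
    ∃ a, EnvyFreeFor u A a ∧ 1 - δ ≤ w a * M := by
  classical
  have hg : ∀ i, ∃ i', (EnvyFreeFor u A i → i' = i₀) ∧
      (¬ EnvyFreeFor u A i → util u A i i < util u A i i') := by
    intro i
    by_cases hi : EnvyFreeFor u A i
    · exact ⟨i₀, fun _ => rfl, fun h => absurd hi h⟩
    · simp only [EnvyFreeFor, not_forall, not_le] at hi
      obtain ⟨i', hi'⟩ := hi
      exact ⟨i', fun h => absurd (h i') hi'.not_ge, fun _ => hi'⟩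
  choose g hgi₀ hglt using hg
  have : Nonempty (Fin n) := ⟨i₀⟩
  obtain ⟨P, hPne, hPmaps, hPinj, -⟩ := exists_finset_bijOn_self g
  have hσinj : Function.Injective fun i => if i ∈ P then g i else i := by
    intro x y hxy
    simp only at hxy
    by_cases hx : x ∈ P <;> by_cases hy : y ∈ P <;> simp only [hx, hy, if_true, if_false] at hxy
    · exact hPinj hx hy hxy
    · exact absurd (hxy ▸ hPmaps hx) hy
    · exact absurd (hxy ▸ hPmaps hy) hx
    · exact hxy
  let σ : Equiv.Perm (Fin n) := Equiv.ofBijective _ (Finite.injective_iff_bijective.1 hσinj)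
  have hσP : ∀ i ∈ P, σ i = g i := fun i hi => if_pos hi
  have hσnP : ∀ i, i ∉ P → σ i = i := fun i hi => if_neg hi
  have hbundle : ∀ i, bundle (fun j => σ.symm (A j)) i = bundle A (σ i) := by
    intro i
    simp only [bundle, Equiv.symm_apply_eq]
  have hfeas : IsFeasible cat s fun j => σ.symm (A j) := by
    intro i h
    rw [hbundle]
    exact hA.1 _ _
  let d : Fin n → ℝ := fun i => w i * ((util u A i (σ i) : ℝ) - util u A i i)
  have hd : ∑ i, d i < δ := by
    have h1 := hA.2 _ hfeas
    simp only [sum_weighted_add_eq u η w A] at h1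
    have h2 := sum_weighted_add_eq u η w fun j => σ.symm (A j)
    have h3 : ∀ i, util u (fun j => σ.symm (A j)) i i = util u A i (σ i) := fun i => by
      rw [util, hbundle, util]
    simp only [h3] at h2
    have h4 := hη₀ fun j => σ.symm (A j)
    have h5 := hηδ A
    simp only [d, mul_sub, Finset.sum_sub_distrib]
    linarith
  have hw₀ : ∀ i, 0 ≤ w i := fun i => hδ.le.trans (hw i)
  have hdP : ∀ i ∈ P, ¬ EnvyFreeFor u A i → w i ≤ d i := by
    intro i hiP hi
    have h1 : (1 : ℝ) ≤ (util u A i (σ i) : ℝ) - util u A i i := by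
      have := hglt i hi
      rw [hσP i hiP]
      exact_mod_cast (show (1 : ℤ) ≤ util u A i (g i) - util u A i i by omega)
    simpa using mul_le_mul_of_nonneg_left h1 (hw₀ i)
  have hdnP : ∀ i, i ∉ P → d i = 0 := fun i hi => by simp [d, hσnP i hi]
  obtain ⟨a, haP, ha⟩ : ∃ a ∈ P, EnvyFreeFor u A a := by
    by_contra! hno
    have hd₀ : ∀ i, 0 ≤ d i := fun i => by
      by_cases hi : i ∈ P
      · exact (hw₀ i).trans (hdP i hi (hno i hi))
      · exact (hdnP i hi).ge
    obtain ⟨p, hp⟩ := hPne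
    have := Finset.single_le_sum (fun i _ => hd₀ i) (Finset.mem_univ p)
    linarith [hdP p hp (hno p hp), hw p]
  refine ⟨a, ha, ?_⟩
  by_cases hai : a = i₀
  · rw [hai, hi₀]
    linarith
  have hother : ∀ i, i ≠ a → 0 ≤ d i := by
    intro i hia
    by_cases hi : i ∈ P
    · refine (hw₀ i).trans (hdP i hi fun hef => hia (hPinj hi haP ?_))
      rw [hgi₀ i hef, hgi₀ a ha]
    · exact (hdnP i hi).ge
  have hi₀P : i₀ ∈ P := by
    rw [← hgi₀ a ha]
    exact hPmaps haP
  have hdi₀ : 1 ≤ d i₀ := by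
    rw [← hi₀]
    refine hdP i₀ hi₀P fun hef => hai (hPinj haP hi₀P ?_)
    rw [hgi₀ a ha, hgi₀ i₀ hef]
  have hda : - (w a * M) ≤ d a := by
    rw [← mul_neg]
    exact mul_le_mul_of_nonneg_left (by linarith [huM A a (σ a)]) (hw₀ a)
  have hge : d a + d i₀ ≤ ∑ i, d i := by
    rw [← Finset.add_sum_erase _ _ (Finset.mem_univ a)]
    gcongr
    exact Finset.single_le_sum (fun i hi => hother i (Finset.ne_of_mem_erase hi))
      (Finset.mem_erase.2 ⟨fun h => hai h.symm, Finset.mem_univ _⟩)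
  linarith

/-- Arbitrarily small positive families of reals exist that are linearly independent over `ℚ`, even
together with `1`. -/
theorem exists_pos_lt_rat_independent (n m : ℕ) {ε : ℝ} (hε : 0 < ε) :
    ∃ η : Fin n → Fin m → ℝ, (∀ i j, 0 < η i j ∧ η i j < ε) ∧
      ∀ (z : Fin n → Fin m → ℚ) (q : ℚ), (q : ℝ) + ∑ i, ∑ j, z i j * η i j = 0 → z = 0 := by
  obtain ⟨x, hx, hx₀, hx₁⟩ : ∃ x : ℝ, Transcendental ℚ x ∧ 0 < x ∧ x < min ε 1 := by
    obtain ⟨x, hx, hx'⟩ := ((Algebraic.countable ℚ ℝ).dense_compl ℝ).exists_mem_open isOpen_Ioo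
      (Set.nonempty_Ioo.2 (lt_min hε one_pos))
    exact ⟨x, hx, hx'.1, hx'.2⟩
  rw [lt_min_iff] at hx₁
  refine ⟨fun i j => x ^ ((finProdFinEquiv (i, j) : ℕ) + 1), fun i j => ⟨pow_pos hx₀ _, ?_⟩, ?_⟩
  · exact (pow_le_of_le_one hx₀.le hx₁.2.le (Nat.succ_ne_zero _)).trans_lt hx₁.1
  · intro z q hzq
    let p : Polynomial ℚ := Polynomial.C q +
      ∑ a : Fin n × Fin m, Polynomial.monomial ((finProdFinEquiv a : ℕ) + 1) (z a.1 a.2)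
    have hp : p = 0 := by
      by_contra hp
      refine hx ⟨p, hp, ?_⟩
      rw [← hzq]
      simp [p, Polynomial.aeval_monomial, Fintype.sum_prod_type]
    funext i j
    have := congrArg (fun p => Polynomial.coeff p ((finProdFinEquiv (i, j) : ℕ) + 1)) hp
    rw [Polynomial.coeff_zero, Polynomial.coeff_add, Polynomial.coeff_C_succ, zero_add,
      Polynomial.finsetSum_coeff, Finset.sum_eq_single (i, j)] at this
    · simpa using this
    · intro a _ ha
      rw [Polynomial.coeff_monomial, if_neg]
      rwa [Nat.succ_inj, Fin.val_inj, EmbeddingLike.apply_eq_iff_eq]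
    · simp

theorem isClosed_setOf_isOptimal {n m k : ℕ} {X : Type*} [TopologicalSpace X] (cat : Fin m → Fin k)
    (s : Fin k → ℕ) {v : X → Fin n → Fin m → ℝ} (hv : ∀ i j, Continuous fun t => v t i j)
    (A : Fin m → Fin n) : IsClosed {t | IsOptimal cat s (v t) A} := by
  by_cases hA : IsFeasible cat s A
  · simp only [IsOptimal, hA, true_and, Set.ofPred_forall]
    exact isClosed_iInter fun B => isClosed_iInter fun _ => isClosed_le
      (continuous_finsetSum _ fun j _ => hv _ _) (continuous_finsetSum _ fun j _ => hv _ _)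
  · simp [IsOptimal, hA]

theorem util_sub_util_le {n m : ℕ} (u : Fin n → Fin m → ℤ) (A : Fin m → Fin n) (i i' : Fin n) :
    util u A i i - util u A i i' ≤ ∑ i, ∑ j, 2 * |u i j| := by
  have habs : ∀ i', |util u A i i'| ≤ ∑ j, |u i j| := fun i' =>
    (Finset.abs_sum_le_sum_abs _ _).trans
      (Finset.sum_le_univ_sum_of_nonneg fun j => abs_nonneg _)
  calc util u A i i - util u A i i' ≤ ∑ j, 2 * |u i j| := by
        rw [← Finset.mul_sum]
        linarith [habs i, habs i', le_abs_self (util u A i i), neg_abs_le (util u A i i')]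
    _ ≤ _ := Finset.single_le_sum (f := fun i => ∑ j, 2 * |u i j|)
      (fun i _ => Finset.sum_nonneg fun j _ => by positivity) (Finset.mem_univ i)

/-- There exist Pareto-optimal feasible allocations `A 1, …, A n` and a set `T` of at most
`n(n-1)` items such that `A i` is envy-free for agent `i`, and all the allocations agree
outside of `T`. -/
theorem statement0 (n m k : ℕ) (u : Fin n → Fin m → ℤ) (cat : Fin m → Fin k) (s : Fin k → ℕ)
    (hcap : ∀ h : Fin k, (Finset.univ.filter (fun j => cat j = h)).card ≤ n * s h) :
    ∃ (A : Fin n → Fin m → Fin n) (T : Finset (Fin m)),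
      T.card ≤ n * (n - 1) ∧
      (∀ i, IsParetoOptimal u cat s (A i)) ∧
      (∀ i, EnvyFreeFor u (A i) i) ∧
      (∀ j : Fin m, j ∉ T → ∀ i i' : Fin n, A i j = A i' j) := by
  classical
  rcases Nat.eq_zero_or_pos n with rfl | hn
  · exact ⟨fun i => i.elim0, ∅, by simp, fun i => i.elim0, fun i => i.elim0,
      fun _ _ i => i.elim0⟩
  have : Nonempty (Fin n) := ⟨⟨0, hn⟩⟩
  have hn₀ : (0 : ℝ) < n := by exact_mod_cast hn
  obtain ⟨M, hM, huM⟩ : ∃ M : ℝ, 1 ≤ M ∧ ∀ (A : Fin m → Fin n) (i i' : Fin n),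
      (util u A i i : ℝ) - util u A i i' ≤ M := by
    refine ⟨((∑ i, ∑ j, 2 * |u i j| : ℤ) : ℝ) + 1, ?_, fun A i i' => ?_⟩
    · have : (0 : ℤ) ≤ ∑ i, ∑ j, 2 * |u i j| := by positivity
      have : (0 : ℝ) ≤ ((∑ i, ∑ j, 2 * |u i j| : ℤ) : ℝ) := by exact_mod_cast this
      linarith
    · have : (util u A i i : ℝ) - util u A i i' ≤ ((∑ i, ∑ j, 2 * |u i j| : ℤ) : ℝ) := by
        exact_mod_cast util_sub_util_le u A i i'
      linarith
  obtain ⟨δ, hδ, hδM⟩ : ∃ δ : ℝ, 0 < δ ∧ δ * (M + 2) = 1 :=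
    ⟨1 / (M + 2), by positivity, by field_simp⟩
  have hδ₁ : δ ≤ 1 := by nlinarith
  obtain ⟨η, hη, hηind⟩ := exists_pos_lt_rat_independent n m (ε := δ / (m + 1)) (by positivity)
  have hη₀ : ∀ A : Fin m → Fin n, 0 ≤ ∑ j, η (A j) j := fun A =>
    Finset.sum_nonneg fun j _ => (hη _ _).1.le
  have hηδ : ∀ A : Fin m → Fin n, ∑ j, η (A j) j < δ := fun A =>
    calc ∑ j, η (A j) j ≤ ∑ _j : Fin m, δ / (m + 1) :=
          Finset.sum_le_sum fun j _ => (hη _ _).2.le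
      _ = m * (δ / (m + 1)) := by simp
      _ < (m + 1) * (δ / (m + 1)) := by gcongr; linarith
      _ = δ := by field_simp
  let μ : (Fin n → ℝ) → ℝ := fun t => Finset.univ.inf' Finset.univ_nonempty t
  have hμ : Continuous μ := Continuous.finset_inf'_apply _ fun i _ => continuous_apply i
  have hμle : ∀ t i, μ t ≤ t i := fun t i => Finset.inf'_le _ (Finset.mem_univ i)
  let w : (Fin n → ℝ) → Fin n → ℝ := fun t i => max δ (1 - 2 * n * (t i - μ t))
  have hw : ∀ t i, δ ≤ w t i := fun t i => le_max_left _ _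
  have hw₁ : ∀ t, ∃ i, w t i = 1 := fun t => by
    obtain ⟨i, -, hi⟩ := Finset.exists_mem_eq_inf' Finset.univ_nonempty t
    refine ⟨i, ?_⟩
    have : t i - μ t = 0 := sub_eq_zero.2 hi.symm
    simp only [w, this, mul_zero, sub_zero, max_eq_right hδ₁]
  let v : (Fin n → ℝ) → Fin n → Fin m → ℝ := fun t i j => w t i * u i j + η i j
  have hv : ∀ i j, Continuous fun t => v t i j := fun i j => by
    have := hμ
    fun_prop
  obtain ⟨t, -, ht⟩ := exists_mem_stdSimplex_forall_mem
    (C := fun i => ⋃ A ∈ {A | EnvyFreeFor u A i}, {t | IsOptimal cat s (v t) A})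
    (fun i => (Set.toFinite _).isClosed_biUnion fun A _ => isClosed_setOf_isOptimal cat s hv A)
    (fun t _ => by
      obtain ⟨A, hA⟩ := exists_isOptimal hcap (v t)
      obtain ⟨i₀, hi₀⟩ := hw₁ t
      obtain ⟨a, ha, hwa⟩ := hA.exists_envyFreeFor hδ (hw t) hη₀ hηδ hi₀ hM huM
      refine ⟨a, Set.mem_biUnion (show A ∈ {A | EnvyFreeFor u A a} from ha) hA, fun i => ?_⟩
      have hlt : δ < w t a := by
        by_contra! hle
        nlinarith
      have hlt' : 2 * n * (t a - μ t) < 1 := by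
        rcases lt_max_iff.1 hlt with h | h <;> linarith
      have : t a - μ t < 1 / (2 * n) := by
        rw [lt_div_iff₀ (by positivity)]
        linarith
      rw [Fintype.card_fin]
      linarith [hμle t i])
  simp only [Set.mem_iUnion, exists_prop] at ht
  choose A hAef hA using ht
  obtain ⟨i₀, hi₀⟩ := hw₁ t
  refine ⟨A, Finset.univ.filter fun j => ∃ B, IsOptimal cat s (v t) B ∧ B j ≠ A i₀ j,
    (hA i₀).card_filter_exists_ne_le hi₀ hηind fun j hj => (Finset.mem_filter.1 hj).2,
    fun i => (hA i).isParetoOptimal hδ (hw t) hη₀ hηδ, hAef, fun j hj i i' => ?_⟩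
  simp only [Finset.mem_filter, Finset.mem_univ, true_and, not_exists, not_and, not_not] at hj
  rw [hj _ (hA i), hj _ (hA i')]
end

section
/- Let there be 2 agents with additive integer utilities u_1, u_2 over m items partitioned into categories S_1,…,S_k with capacities s_h, where |S_h| = 2·s_h for all h and every feasible allocation assigns exactly s_h items of each category to each agent. Suppose A and A' are two Pareto-optimal feasible allocations obtained from each other by swapping two items, i.e., there exist items j, j' and disjoint sets I_1, I_2 with A_1 = I_1 ∪ {j}, A_2 = I_2 ∪ {j'}, A'_1 = I_1 ∪ {j'}, A'_2 = I_2 ∪ {j}, such that agent 1 is envy-free in one of A, A' and agent 2 is envy-free in the other. Then at least one of A and A' is both Pareto-optimal and EF[1,1]. -/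
/-- EF[1,1]: for every pair of agents `i, i'` there are sets `S ⊆ A_i` and `T ⊆ A_{i'}` of
size at most one with `u_i(A_i \ S) ≥ u_i(A_{i'} \ T)`. -/
def EF11 {n m : ℕ} (u : Fin n → Fin m → ℤ) (A : Fin m → Fin n) : Prop :=
  ∀ i i' : Fin n, ∃ S T : Finset (Fin m),
    S ⊆ bundle A i ∧ T ⊆ bundle A i' ∧ S.card ≤ 1 ∧ T.card ≤ 1 ∧
      ∑ j ∈ bundle A i' \ T, u i j ≤ ∑ j ∈ bundle A i \ S, u i j

theorem EnvyFreeFor.exists_removal {n m : ℕ} {u : Fin n → Fin m → ℤ} {A : Fin m → Fin n}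
    {i : Fin n} (h : EnvyFreeFor u A i) (i' : Fin n) :
    ∃ S T : Finset (Fin m),
      S ⊆ bundle A i ∧ T ⊆ bundle A i' ∧ S.card ≤ 1 ∧ T.card ≤ 1 ∧
        ∑ j ∈ bundle A i' \ T, u i j ≤ ∑ j ∈ bundle A i \ S, u i j :=
  ⟨∅, ∅, by simp, by simp, by simp, by simp, by simpa [util] using h i'⟩

/-- With two agents, if `i` is envy-free and `i'` weakly prefers its own bundle to that of `i`
once one item has been removed from each, then the allocation is EF[1,1]. -/
theorem ef11_of_envyFreeFor_of_insert {m : ℕ} {u : Fin 2 → Fin m → ℤ} {A : Fin m → Fin 2}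
    {i i' : Fin 2} (hii' : i ≠ i') {j j' : Fin m} {I I' : Finset (Fin m)}
    (hi : bundle A i = insert j I) (hi' : bundle A i' = insert j' I')
    (hj : j ∉ I) (hj' : j' ∉ I') (hef : EnvyFreeFor u A i)
    (hle : ∑ x ∈ I, u i' x ≤ ∑ x ∈ I', u i' x) : EF11 u A := by
  intro a b
  have ha : a = i ∨ a = i' := by omega
  rcases ha with rfl | rfl
  · exact hef.exists_removal b
  have hb : b = a ∨ b = i := by omega
  rcases hb with rfl | rfl
  · exact ⟨∅, ∅, by simp, by simp, by simp, by simp, le_rfl⟩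
  refine ⟨{j'}, {j}, by simp [hi'], by simp [hi], by simp, by simp, ?_⟩
  simpa [hi, hi', ← Finset.erase_eq, Finset.erase_eq_of_notMem, hj, hj'] using hle

theorem bundle_rev_comp {n m : ℕ} (A : Fin m → Fin n) (i : Fin n) :
    bundle (Fin.rev ∘ A) i = bundle A i.rev := by
  ext x
  simp [bundle, Fin.rev_eq_iff]

theorem IsFeasible.rev_comp {n m k : ℕ} {cat : Fin m → Fin k} {s : Fin k → ℕ}
    {A : Fin m → Fin n} (h : IsFeasible cat s A) : IsFeasible cat s (Fin.rev ∘ A) := by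
  intro i c
  rw [bundle_rev_comp]
  exact h i.rev c

/-- If agent 0 is envy-free in `A` and agent 1 is envy-free in `A'`, where `A'` arises from `A`
by swapping two items and `A` is Pareto-optimal, then `A` or `A'` is EF[1,1]: otherwise
exchanging the two bundles of `A'` would Pareto-dominate `A`. -/
theorem ef11_or_ef11_of_swap {m k : ℕ} {u : Fin 2 → Fin m → ℤ} {cat : Fin m → Fin k}
    {s : Fin k → ℕ} {A A' : Fin m → Fin 2}
    (hA : IsParetoOptimal u cat s A) (hA' : IsFeasible cat s A')
    {j j' : Fin m} {I₁ I₂ : Finset (Fin m)}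
    (hjI : j ∉ I₁ ∪ I₂) (hj'I : j' ∉ I₁ ∪ I₂)
    (hA1 : bundle A 0 = insert j I₁) (hA2 : bundle A 1 = insert j' I₂)
    (hA'1 : bundle A' 0 = insert j' I₁) (hA'2 : bundle A' 1 = insert j I₂)
    (hef : EnvyFreeFor u A 0) (hef' : EnvyFreeFor u A' 1) :
    EF11 u A ∨ EF11 u A' := by
  simp only [Finset.mem_union, not_or] at hjI hj'I
  obtain ⟨hj₁, hj₂⟩ := hjI
  obtain ⟨hj'₁, hj'₂⟩ := hj'I
  by_cases h₁ : ∑ x ∈ I₁, u 1 x ≤ ∑ x ∈ I₂, u 1 x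
  · exact .inl (ef11_of_envyFreeFor_of_insert (by decide) hA1 hA2 hj₁ hj'₂ hef h₁)
  by_cases h₂ : ∑ x ∈ I₂, u 0 x ≤ ∑ x ∈ I₁, u 0 x
  · exact .inr (ef11_of_envyFreeFor_of_insert (by decide) hA'2 hA'1 hj₂ hj'₁ hef' h₂)
  have hlt : ∀ i, util u A i i < util u (Fin.rev ∘ A') i i := by
    rw [Fin.forall_fin_two]
    have h0 : (0 : Fin 2).rev = 1 := rfl
    have h1 : (1 : Fin 2).rev = 0 := rfl
    simp only [util, bundle_rev_comp, h0, h1, hA1, hA2, hA'1, hA'2, Finset.sum_insert hj₁,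
      Finset.sum_insert hj₂, Finset.sum_insert hj'₁, Finset.sum_insert hj'₂]
    constructor <;> linarith
  exact absurd ⟨_, hA'.rev_comp, fun i => (hlt i).le, 0, hlt 0⟩ hA.2

/-- If two Pareto-optimal feasible allocations for two agents are obtained from each other by
swapping two items `j, j'`, agent 1 is envy-free in one and agent 2 is envy-free in the other,
then one of the two allocations is both Pareto-optimal and EF[1,1]. -/
theorem statement2 (m k : ℕ) (u : Fin 2 → Fin m → ℤ) (cat : Fin m → Fin k) (s : Fin k → ℕ)
    (hcap : ∀ h : Fin k, (Finset.univ.filter (fun j => cat j = h)).card = 2 * s h)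
    (A A' : Fin m → Fin 2)
    (hA : IsParetoOptimal u cat s A) (hA' : IsParetoOptimal u cat s A')
    (j j' : Fin m) (I₁ I₂ : Finset (Fin m))
    (hjj' : j ≠ j') (hdisj : Disjoint I₁ I₂)
    (hjI : j ∉ I₁ ∪ I₂) (hj'I : j' ∉ I₁ ∪ I₂)
    (hA1 : bundle A 0 = insert j I₁) (hA2 : bundle A 1 = insert j' I₂)
    (hA'1 : bundle A' 0 = insert j' I₁) (hA'2 : bundle A' 1 = insert j I₂)
    (hef : (EnvyFreeFor u A 0 ∧ EnvyFreeFor u A' 1) ∨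
           (EnvyFreeFor u A' 0 ∧ EnvyFreeFor u A 1)) :
    (IsParetoOptimal u cat s A ∧ EF11 u A) ∨ (IsParetoOptimal u cat s A' ∧ EF11 u A') := by
  rcases hef with ⟨h₀, h₁⟩ | ⟨h₀, h₁⟩
  · exact (ef11_or_ef11_of_swap hA hA'.1 hjI hj'I hA1 hA2 hA'1 hA'2 h₀ h₁).imp
      (⟨hA, ·⟩) (⟨hA', ·⟩)
  · exact (ef11_or_ef11_of_swap hA' hA.1 hj'I hjI hA'1 hA'2 hA1 hA2 h₀ h₁).symm.imp
      (⟨hA, ·⟩) (⟨hA', ·⟩)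
end

section
/- Fix a point t = (t_1,…,t_n) of the (n−1)-dimensional standard simplex and reals ε_{ij} > 0 with ε_{ij} < 1/(K·n·m) for all i ∈ [n], j ∈ [m], where K = n·Σ_{i=1}^n Σ_{j=1}^m |u_i(j)| + 1. Then every feasible allocation A* maximizing the objective W(A) = (1/K)·Σ_{i=1}^n (1 + (K−n)·t_i)·u_i(A_i) + Σ_{i=1}^n Σ_{j∈A_i} ε_{ij} over all feasible allocations is Pareto-optimal. -/
/-- The objective `W(A) = (1/K)·Σ_i (1 + (K−n)·t_i)·u_i(A_i) + Σ_i Σ_{j∈A_i} ε_{ij}`. -/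
noncomputable def objW {n m : ℕ} (u : Fin n → Fin m → ℤ) (K : ℤ) (t : Fin n → ℝ) (ε : Fin n → Fin m → ℝ)
    (A : Fin m → Fin n) : ℝ :=
  (1 / (K : ℝ)) * ∑ i, (1 + ((K : ℝ) - (n : ℝ)) * t i) * (util u A i i : ℝ)
    + ∑ i, ∑ j ∈ bundle A i, ε i j

lemma sum_sum_bundle {n m : ℕ} (ε : Fin n → Fin m → ℝ) (A : Fin m → Fin n) :
    ∑ i, ∑ j ∈ bundle A i, ε i j = ∑ j, ε (A j) j := by
  rw [← Finset.sum_fiberwise Finset.univ A (fun j => ε (A j) j)]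
  refine Finset.sum_congr rfl fun i _ => Finset.sum_congr rfl fun j hj => ?_
  rw [(Finset.mem_filter.mp hj).2]

/-- If agent `i` values two allocations differently, the total absolute utility is positive. -/
lemma one_le_sum_abs_of_util_ne {n m : ℕ} {u : Fin n → Fin m → ℤ} {A A' : Fin m → Fin n}
    {i : Fin n} (h : util u A i i ≠ util u A' i i) : 1 ≤ ∑ i, ∑ j, |u i j| := by
  by_contra! hlt
  have hnn : ∀ i ∈ Finset.univ, 0 ≤ ∑ j, |u i j| :=
    fun i _ => Finset.sum_nonneg fun j _ => abs_nonneg _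
  have h0 : ∑ i, ∑ j, |u i j| = 0 := le_antisymm (by omega) (Finset.sum_nonneg hnn)
  have hi := (Finset.sum_eq_zero_iff_of_nonneg hnn).1 h0 i (Finset.mem_univ i)
  have hu : ∀ j, u i j = 0 := fun j => abs_eq_zero.1 <|
    (Finset.sum_eq_zero_iff_of_nonneg fun j _ => abs_nonneg (u i j)).1 hi j (Finset.mem_univ j)
  exact h (by simp [util, hu])

/-- For weights at least one, a Pareto improvement of integer values increases the weighted sum
by at least one. -/
lemma sum_mul_add_one_le {n : ℕ} {w : Fin n → ℝ} (hw : ∀ i, 1 ≤ w i) {a b : Fin n → ℤ}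
    (hab : ∀ i, a i ≤ b i) (hlt : ∃ i, a i < b i) :
    ∑ i, w i * (a i : ℝ) + 1 ≤ ∑ i, w i * (b i : ℝ) := by
  have h1 : ∑ i, a i + 1 ≤ ∑ i, b i :=
    Finset.sum_lt_sum (fun i _ => hab i) (hlt.imp fun i hi => ⟨Finset.mem_univ i, hi⟩)
  have h2 : ∑ i, (a i : ℝ) + 1 ≤ ∑ i, (b i : ℝ) := by exact_mod_cast h1
  have h3 : ∑ i, ((b i : ℝ) - a i) ≤ ∑ i, (w i * (b i : ℝ) - w i * a i) := by
    refine Finset.sum_le_sum fun i _ => ?_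
    have hi : (a i : ℝ) ≤ b i := by exact_mod_cast hab i
    nlinarith [hw i]
  rw [Finset.sum_sub_distrib, Finset.sum_sub_distrib] at h3
  linarith

/-- If `ε_{ij} < 1/(K·n·m)` for all `i, j`, then every feasible allocation maximizing the
objective `W` over all feasible allocations is Pareto-optimal. -/
theorem statement3 (n m k : ℕ) (u : Fin n → Fin m → ℤ) (cat : Fin m → Fin k) (s : Fin k → ℕ)
    (hcap : ∀ h : Fin k, (Finset.univ.filter (fun j => cat j = h)).card = n * s h)
    (t : Fin n → ℝ) (ht0 : ∀ i, 0 ≤ t i) (ht1 : ∑ i, t i = 1)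
    (K : ℤ) (hK : K = n * (∑ i, ∑ j, |u i j|) + 1)
    (ε : Fin n → Fin m → ℝ) (hε0 : ∀ i j, 0 < ε i j)
    (hεsmall : ∀ i j, ε i j < 1 / ((K : ℝ) * (n : ℝ) * (m : ℝ)))
    (A : Fin m → Fin n) (hAfeas : IsFeasible cat s A)
    (hAopt : ∀ A' : Fin m → Fin n, IsFeasible cat s A' → objW u K t ε A' ≤ objW u K t ε A) :
    IsParetoOptimal u cat s A := by
  refine ⟨hAfeas, ?_⟩
  rintro ⟨A', hA', hle, i₀, hi₀⟩
  have hU := one_le_sum_abs_of_util_ne hi₀.ne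
  have hn : (1 : ℝ) ≤ n := by exact_mod_cast i₀.pos
  have hnK : (n : ℝ) + 1 ≤ K := by
    have : (n : ℤ) + 1 ≤ K := by
      rw [hK]
      nlinarith [Int.natCast_nonneg n]
    exact_mod_cast this
  have hm : 0 < m := by
    rcases Nat.eq_zero_or_pos m with rfl | hm
    · simp [util, Finset.eq_empty_of_isEmpty] at hi₀
    · exact hm
  have hm' : (0 : ℝ) < m := by exact_mod_cast hm
  have hKpos : (0 : ℝ) < K := by linarith
  have hεA : ∑ j, ε (A j) j < 1 / (K : ℝ) := by
    have : Nonempty (Fin m) := ⟨⟨0, hm⟩⟩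
    calc ∑ j, ε (A j) j < ∑ _j : Fin m, 1 / ((K : ℝ) * n * m) :=
          Finset.sum_lt_sum_of_nonempty Finset.univ_nonempty fun j _ => hεsmall _ _
      _ = 1 / ((K : ℝ) * n) := by
          simp only [Finset.sum_const, Finset.card_univ, Fintype.card_fin, nsmul_eq_mul]
          field_simp
      _ ≤ 1 / (K : ℝ) := one_div_le_one_div_of_le hKpos (le_mul_of_one_le_right hKpos.le hn)
  have hεA' : 0 ≤ ∑ j, ε (A' j) j := Finset.sum_nonneg fun j _ => (hε0 _ _).le
  have hw : ∀ i, 1 ≤ 1 + ((K : ℝ) - n) * t i := fun i => by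
    have := mul_nonneg (by linarith : (0 : ℝ) ≤ K - n) (ht0 i)
    linarith
  have hgain := mul_le_mul_of_nonneg_left (sum_mul_add_one_le hw hle ⟨i₀, hi₀⟩)
    (one_div_pos.2 hKpos).le
  have hopt := hAopt A' hA'
  rw [objW, objW, sum_sum_bundle, sum_sum_bundle] at hopt
  rw [mul_add, mul_one] at hgain
  linarith
end

section
/- Fix a point t = (t_1,…,t_n) of the (n−1)-dimensional standard simplex and reals ε_{ij} > 0 with ε_{ij} < 1/(K·n²·m) for all i ∈ [n], j ∈ [m], where K = n·Σ_{i=1}^n Σ_{j=1}^m |u_i(j)| + 1. Then every feasible allocation A* maximizing the objective W(A) = (1/K)·Σ_{i=1}^n (1 + (K−n)·t_i)·u_i(A_i) + Σ_{i=1}^n Σ_{j∈A_i} ε_{ij} over all feasible allocations is envy-free for some agent i* with t_{i*} > 0. -/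
/-- A self-map of a nonempty finite type has a periodic point. -/
theorem exists_mem_periodicPts {α : Type*} [Finite α] [Nonempty α] (f : α → α) :
    ∃ x, x ∈ Function.periodicPts f := by
  obtain ⟨x⟩ := ‹Nonempty α›
  obtain ⟨a, b, hab, h⟩ := Finite.exists_ne_map_eq_of_infinite (fun l : ℕ => f^[l] x)
  wlog hlt : a < b generalizing a b
  · exact this b a hab.symm h.symm (by omega)
  refine ⟨f^[a] x, Function.mk_mem_periodicPts (n := b - a) (by omega) ?_⟩
  simp only [Function.IsPeriodicPt, Function.IsFixedPt]
  rw [← Function.iterate_add_apply, Nat.sub_add_cancel hlt.le]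
  exact h.symm

/-- A self-map of a finite type agrees with a permutation on its periodic points, and this
permutation can be chosen to fix all other points. -/
theorem exists_perm_eq_on_periodicPts {α : Type*} [Finite α] (f : α → α) :
    ∃ σ : Equiv.Perm α, (∀ x ∈ Function.periodicPts f, σ x = f x) ∧
      ∀ x ∉ Function.periodicPts f, σ x = x := by
  classical
  have hbij := Function.bijOn_periodicPts f
  have hinj : Function.Injective
      (fun x => if x ∈ Function.periodicPts f then f x else x) := by
    intro x y hxy
    by_cases hx : x ∈ Function.periodicPts f <;> by_cases hy : y ∈ Function.periodicPts f
    · exact hbij.injOn hx hy (by simpa [hx, hy] using hxy)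
    · have h : f x = y := by simpa [hx, hy] using hxy
      exact absurd (h ▸ hbij.mapsTo hx) hy
    · have h : x = f y := by simpa [hx, hy] using hxy
      exact absurd (h ▸ hbij.mapsTo hy) hx
    · simpa [hx, hy] using hxy
  refine ⟨Equiv.ofBijective _ (Finite.injective_iff_bijective.mp hinj), ?_, ?_⟩
  · intro x hx
    simp [hx]
  · intro x hx
    simp [hx]

/-- Reassigning the bundles along a permutation. -/
theorem bundle_perm {n m : ℕ} (A : Fin m → Fin n) (σ : Equiv.Perm (Fin n)) (i : Fin n) :
    bundle (fun j => σ.symm (A j)) i = bundle A (σ i) := by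
  ext j
  simp [bundle, Equiv.symm_apply_eq]

/-- Utilities of two different bundles differ by at most the total absolute utility. -/
theorem util_sub_le {n m : ℕ} (u : Fin n → Fin m → ℤ) (A : Fin m → Fin n) (i : Fin n)
    {a b : Fin n} (hab : a ≠ b) :
    util u A i a - util u A i b ≤ ∑ i, ∑ j, |u i j| := by
  have hdisj : Disjoint (bundle A a) (bundle A b) := by
    rw [Finset.disjoint_left]
    intro j ha hb
    simp only [bundle, Finset.mem_filter, Finset.mem_univ, true_and] at ha hb
    exact hab (ha.symm.trans hb)
  calc util u A i a - util u A i b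
      ≤ ∑ j ∈ bundle A a, |u i j| + ∑ j ∈ bundle A b, |u i j| := by
        have h1 : util u A i a ≤ ∑ j ∈ bundle A a, |u i j| :=
          Finset.sum_le_sum fun j _ => le_abs_self _
        have h2 : -util u A i b ≤ ∑ j ∈ bundle A b, |u i j| := by
          rw [util, ← Finset.sum_neg_distrib]
          exact Finset.sum_le_sum fun j _ => neg_le_abs _
        linarith
    _ = ∑ j ∈ bundle A a ∪ bundle A b, |u i j| := (Finset.sum_union hdisj).symm
    _ ≤ ∑ j, |u i j| :=
        Finset.sum_le_sum_of_subset_of_nonneg (Finset.subset_univ _) fun _ _ _ => abs_nonneg _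
    _ ≤ ∑ i, ∑ j, |u i j| :=
        Finset.single_le_sum (f := fun i => ∑ j, |u i j|)
          (fun _ _ => Finset.sum_nonneg fun _ _ => abs_nonneg _) (Finset.mem_univ i)

/-- Summing over all bundles is summing over all items. -/
theorem sum_bundle_eq {n m : ℕ} (A : Fin m → Fin n) (ε : Fin n → Fin m → ℝ) :
    ∑ i, ∑ j ∈ bundle A i, ε i j = ∑ j, ε (A j) j := by
  rw [← Finset.sum_fiberwise Finset.univ A]
  refine Finset.sum_congr rfl fun i _ => Finset.sum_congr rfl fun j hj => ?_
  rw [(Finset.mem_filter.mp hj).2]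

/-- If no agent of positive weight is satisfied, some permutation of the bundles increases the
weighted utility by at least `1 / n`. -/
theorem exists_perm_weighted_gain {n m : ℕ} (u : Fin n → Fin m → ℤ) (A : Fin m → Fin n)
    (t : Fin n → ℝ) (ht0 : ∀ i, 0 ≤ t i) (ht1 : ∑ i, t i = 1)
    (K : ℤ) (hK : K = n * (∑ i, ∑ j, |u i j|) + 1) (hnK : (n : ℤ) ≤ K)
    (henvy : ∀ i, 0 < t i → ¬ EnvyFreeFor u A i) :
    ∃ σ : Equiv.Perm (Fin n), 1 / (n : ℝ) ≤
      ∑ i, (1 + ((K : ℝ) - n) * t i) * ((util u A i (σ i) : ℝ) - util u A i i) := by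
  classical
  have hne : Nonempty (Fin n) := by
    by_contra h
    rw [not_nonempty_iff] at h
    simp at ht1
  have hn : 0 < n := Fin.pos_iff_nonempty.mpr hne
  have hn' : (1 : ℝ) ≤ n := by exact_mod_cast hn
  have hnK' : (n : ℝ) ≤ K := by exact_mod_cast hnK
  have hKU : (K : ℝ) = n * ((∑ i, ∑ j, |u i j| : ℤ) : ℝ) + 1 := by rw [hK]; push_cast; ring
  obtain ⟨i₀, hi₀⟩ : ∃ i, 1 / (n : ℝ) ≤ t i := by
    by_contra! h
    have := Finset.sum_lt_sum_of_nonempty (s := Finset.univ) Finset.univ_nonempty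
      fun i _ => h i
    rw [ht1, Finset.sum_const, Finset.card_univ, Fintype.card_fin, nsmul_eq_mul,
      mul_one_div_cancel (by positivity)] at this
    exact lt_irrefl _ this
  have hi₀pos : 0 < t i₀ := lt_of_lt_of_le (by positivity) hi₀
  have hweight : ∀ i, (1 : ℝ) ≤ 1 + ((K : ℝ) - n) * t i := fun i => by
    nlinarith [mul_nonneg (sub_nonneg.mpr hnK') (ht0 i)]
  have hweight₀ : (K : ℝ) / n ≤ 1 + ((K : ℝ) - n) * t i₀ := by
    have h := mul_le_mul_of_nonneg_left hi₀ (sub_nonneg.mpr hnK')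
    have h' : ((K : ℝ) - n) * (1 / n) = K / n - 1 := by field_simp
    linarith
  have hsucc : ∀ i, ∃ i', (¬ EnvyFreeFor u A i → util u A i i < util u A i i') ∧
      (EnvyFreeFor u A i → i' = i₀) := by
    intro i
    by_cases h : EnvyFreeFor u A i
    · exact ⟨i₀, fun h' => absurd h h', fun _ => rfl⟩
    · obtain ⟨i', hi'⟩ := not_forall.mp h
      exact ⟨i', fun _ => not_le.mp hi', fun h' => absurd h' h⟩
  choose f hf hf₀ using hsucc
  obtain ⟨σ, hσ, hσ'⟩ := exists_perm_eq_on_periodicPts f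
  refine ⟨σ, ?_⟩
  have hgain : ∀ i ∈ Function.periodicPts f, ¬ EnvyFreeFor u A i →
      (1 : ℝ) ≤ (util u A i (σ i) : ℝ) - util u A i i := by
    intro i hi h
    have h1 : (util u A i i + 1 : ℤ) ≤ util u A i (σ i) := by
      rw [hσ i hi]; exact hf i h
    have h2 : ((util u A i i + 1 : ℤ) : ℝ) ≤ util u A i (σ i) := by exact_mod_cast h1
    push_cast at h2
    linarith
  by_cases hr : ∃ r ∈ Function.periodicPts f, EnvyFreeFor u A r
  · obtain ⟨r, hrp, hre⟩ := hr
    have hσr : σ r = i₀ := by rw [hσ r hrp, hf₀ r hre]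
    have hri₀ : r ≠ i₀ := fun h => henvy i₀ hi₀pos (h ▸ hre)
    have hi₀p : i₀ ∈ Function.periodicPts f := by
      rw [← hf₀ r hre]; exact (Function.bijOn_periodicPts f).mapsTo hrp
    have htr : t r = 0 := le_antisymm (not_lt.mp fun h => henvy r h hre) (ht0 r)
    have hloss : (util u A r r : ℝ) - util u A r i₀ ≤ ((∑ i, ∑ j, |u i j| : ℤ) : ℝ) := by
      exact_mod_cast util_sub_le u A r hri₀
    calc 1 / (n : ℝ) = K / n - ((∑ i, ∑ j, |u i j| : ℤ) : ℝ) := by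
          rw [hKU]; field_simp; ring
      _ = ∑ i, ((if i = i₀ then (K : ℝ) / n else 0)
            - (if i = r then ((∑ i, ∑ j, |u i j| : ℤ) : ℝ) else 0)) := by
          rw [Finset.sum_sub_distrib, Finset.sum_ite_eq' Finset.univ i₀,
            Finset.sum_ite_eq' Finset.univ r]
          simp only [Finset.mem_univ, if_true]
      _ ≤ _ := Finset.sum_le_sum fun i _ => ?_
    by_cases hir : i = r
    · subst hir
      rw [if_neg hri₀, if_pos rfl, htr, hσr]
      linarith
    rw [if_neg hir, sub_zero]
    by_cases hii : i = i₀
    · subst hii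
      rw [if_pos rfl]
      have h := hgain i hi₀p (henvy i hi₀pos)
      exact hweight₀.trans (le_mul_of_one_le_right (zero_le_one.trans (hweight i)) h)
    rw [if_neg hii]
    refine mul_nonneg (zero_le_one.trans (hweight i)) ?_
    by_cases hip : i ∈ Function.periodicPts f
    · refine zero_le_one.trans (hgain i hip fun he => hir (σ.injective ?_))
      rw [hσr, hσ i hip, hf₀ i he]
    · rw [hσ' i hip, sub_self]
  · push Not at hr
    obtain ⟨p, hp⟩ := exists_mem_periodicPts f
    have hterm : ∀ i, 0 ≤ (1 + ((K : ℝ) - n) * t i)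
        * ((util u A i (σ i) : ℝ) - util u A i i) := by
      intro i
      refine mul_nonneg (zero_le_one.trans (hweight i)) ?_
      by_cases hip : i ∈ Function.periodicPts f
      · exact zero_le_one.trans (hgain i hip (hr i hip))
      · rw [hσ' i hip, sub_self]
    calc 1 / (n : ℝ) ≤ 1 := (div_le_one (by positivity)).mpr hn'
      _ ≤ _ := one_le_mul_of_one_le_of_one_le (hweight p) (hgain p hp (hr p hp))
      _ ≤ _ := Finset.single_le_sum (fun i _ => hterm i) (Finset.mem_univ p)

/-- If `ε_{ij} < 1/(K·n²·m)` for all `i, j`, then every feasible allocation maximizing the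
objective `W` over all feasible allocations is envy-free for some agent `i*` with `t_{i*} > 0`. -/
theorem statement4 (n m k : ℕ) (u : Fin n → Fin m → ℤ) (cat : Fin m → Fin k) (s : Fin k → ℕ)
    (hcap : ∀ h : Fin k, (Finset.univ.filter (fun j => cat j = h)).card = n * s h)
    (t : Fin n → ℝ) (ht0 : ∀ i, 0 ≤ t i) (ht1 : ∑ i, t i = 1)
    (K : ℤ) (hK : K = n * (∑ i, ∑ j, |u i j|) + 1)
    (ε : Fin n → Fin m → ℝ) (hε0 : ∀ i j, 0 < ε i j)
    (hεsmall : ∀ i j, ε i j < 1 / ((K : ℝ) * (n : ℝ) ^ 2 * (m : ℝ)))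
    (A : Fin m → Fin n) (hAfeas : IsFeasible cat s A)
    (hAopt : ∀ A' : Fin m → Fin n, IsFeasible cat s A' → objW u K t ε A' ≤ objW u K t ε A) :
    ∃ i : Fin n, 0 < t i ∧ EnvyFreeFor u A i := by
  by_contra! hcon
  have hn : 0 < n := by
    rcases Nat.eq_zero_or_pos n with h | h
    · subst h; simp at ht1
    · exact h
  obtain ⟨p, hp⟩ : ∃ p, 0 < t p := by
    by_contra! h
    have := Finset.sum_nonpos fun i (_ : i ∈ Finset.univ) => h i
    linarith
  obtain ⟨q, hq⟩ := not_forall.mp (hcon p hp)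
  have hU : 1 ≤ ∑ i, ∑ j, |u i j| := by
    have hqp : q ≠ p := fun h => hq (h ▸ le_rfl)
    have := util_sub_le u A p hqp
    omega
  have hm : 0 < m := by
    rcases Nat.eq_zero_or_pos m with h | h
    · subst h; simp at hU
    · exact h
  have hnK : (n : ℤ) ≤ K := by
    rw [hK]; nlinarith
  have hn' : (1 : ℝ) ≤ n := by exact_mod_cast hn
  have hm' : (0 : ℝ) < m := by exact_mod_cast hm
  have hnK' : (n : ℝ) ≤ K := by exact_mod_cast hnK
  have hK0 : (0 : ℝ) < K := by linarith
  obtain ⟨σ, hσ⟩ := exists_perm_weighted_gain u A t ht0 ht1 K hK hnK hcon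
  have hopt := hAopt (fun j => σ.symm (A j)) fun i h => by
    rw [bundle_perm]; exact hAfeas (σ i) h
  have hutil : ∀ i, util u (fun j => σ.symm (A j)) i i = util u A i (σ i) := fun i => by
    rw [util, bundle_perm, util]
  have hεpos : 0 ≤ ∑ i, ∑ j ∈ bundle (fun j => σ.symm (A j)) i, ε i j :=
    Finset.sum_nonneg fun i _ => Finset.sum_nonneg fun j _ => (hε0 i j).le
  have hεlt : ∑ i, ∑ j ∈ bundle A i, ε i j < 1 / K * (1 / n) := by
    rw [sum_bundle_eq]
    have hne : (Finset.univ : Finset (Fin m)).Nonempty := ⟨⟨0, hm⟩, Finset.mem_univ _⟩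
    calc ∑ j, ε (A j) j < ∑ _j : Fin m, 1 / ((K : ℝ) * (n : ℝ) ^ 2 * (m : ℝ)) :=
          Finset.sum_lt_sum_of_nonempty hne fun j _ => hεsmall (A j) j
      _ = 1 / K * (1 / n) * (1 / n) := by
          rw [Finset.sum_const, Finset.card_univ, Fintype.card_fin, nsmul_eq_mul]
          field_simp
      _ ≤ 1 / K * (1 / n) :=
          mul_le_of_le_one_right (by positivity) ((div_le_one (by positivity)).mpr hn')
  have hgain := mul_le_mul_of_nonneg_left hσ (one_div_pos.mpr hK0).le
  simp only [mul_sub, Finset.sum_sub_distrib] at hgain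
  simp only [objW, hutil] at hopt
  linarith
end

section
/- Let c^1, c^2, …, c^q be vectors in ℝ^d, let M be an r×d real matrix and b ∈ ℝ^r. For every α > 0 there exist reals ε_1,…,ε_d ∈ (0, α) such that for every point t' = (t'_1,…,t'_q) of the (q−1)-dimensional standard simplex, the set of optimal solutions of the linear program max c(t')·x subject to Mx = b, x ∈ ℝ^d_{≥0}, where c_s(t') = Σ_{i=1}^q t'_i·c^i_s + ε_s for s ∈ [d], has affine dimension at most q−1 (whenever it is nonempty). -/
/-- Feasibility for the linear program `max c·x s.t. Mx = b, x ≥ 0`. -/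
def LPFeasible {r d : ℕ} (M : Matrix (Fin r) (Fin d) ℝ) (b : Fin r → ℝ) (x : Fin d → ℝ) : Prop :=
  (∀ i, ∑ s, M i s * x s = b i) ∧ ∀ s, 0 ≤ x s

/-- The optimal face of the linear program `max c·x s.t. Mx = b, x ≥ 0`. -/
def OptimalFace {r d : ℕ} (M : Matrix (Fin r) (Fin d) ℝ) (b : Fin r → ℝ) (c : Fin d → ℝ) :
    Set (Fin d → ℝ) :=
  {x | LPFeasible M b x ∧ ∀ y, LPFeasible M b y → ∑ s, c s * y s ≤ ∑ s, c s * x s}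

open Module

/-- The vectors in the kernel of `M` whose support is contained in `S`. -/
def supportedKernel {r d : ℕ} (M : Matrix (Fin r) (Fin d) ℝ) (S : Finset (Fin d)) :
    Submodule ℝ (Fin d → ℝ) where
  carrier := {v | (∀ i, ∑ s, M i s * v s = 0) ∧ ∀ s, s ∉ S → v s = 0}
  zero_mem' := by simp
  add_mem' := by
    rintro v w ⟨hv, hv'⟩ ⟨hw, hw'⟩
    refine ⟨fun i => ?_, fun s hs => ?_⟩
    · simp [mul_add, Finset.sum_add_distrib, hv i, hw i]
    · simp [hv' s hs, hw' s hs]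
  smul_mem' := by
    rintro a v ⟨hv, hv'⟩
    refine ⟨fun i => ?_, fun s hs => ?_⟩
    · simp [mul_left_comm _ a, ← Finset.mul_sum, hv i]
    · simp [hv' s hs]

/-- The functional on a subspace `V` induced by the dot product with a vector. -/
def restrictedDot {d : ℕ} (V : Submodule ℝ (Fin d → ℝ)) : (Fin d → ℝ) →ₗ[ℝ] Dual ℝ V :=
  V.dualRestrict ∘ₗ dotProductBilin ℝ ℝ

lemma restrictedDot_apply {d : ℕ} (V : Submodule ℝ (Fin d → ℝ)) (c : Fin d → ℝ) (v : V) :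
    restrictedDot V c v = ∑ s, c s * v.1 s := rfl

lemma restrictedDot_surjective {d : ℕ} (V : Submodule ℝ (Fin d → ℝ)) :
    Function.Surjective (restrictedDot V) := by
  intro f
  obtain ⟨g, hg⟩ := f.exists_extend
  refine ⟨fun s => g (Pi.single s 1), LinearMap.ext fun v => ?_⟩
  rw [restrictedDot_apply, ← hg, LinearMap.comp_apply, Submodule.subtype_apply,
    LinearMap.pi_apply_eq_sum_univ g v.1]
  refine Finset.sum_congr rfl fun s _ => ?_
  rw [smul_eq_mul, mul_comm]
  congr 2
  ext j
  simp [Pi.single_apply, eq_comm]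

/-- The perturbations `ε` for which some affine combination of the `c i`, shifted by `ε`, vanishes
on `V`. -/
def degeneratePerturbations {q d : ℕ} (c : Fin q → Fin d → ℝ) (V : Submodule ℝ (Fin d → ℝ)) :
    AffineSubspace ℝ (Fin d → ℝ) :=
  (affineSpan ℝ (Set.range fun i => -restrictedDot V (c i))).comap (restrictedDot V).toAffineMap

lemma degeneratePerturbations_ne_top {q d : ℕ} (hq : 0 < q) (c : Fin q → Fin d → ℝ)
    (V : Submodule ℝ (Fin d → ℝ)) (hV : q ≤ finrank ℝ V) : degeneratePerturbations c V ≠ ⊤ := by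
  intro h
  have htop : affineSpan ℝ (Set.range fun i => -restrictedDot V (c i)) = ⊤ := by
    refine top_unique fun f _ => ?_
    obtain ⟨x, rfl⟩ := restrictedDot_surjective V f
    have hx : x ∈ degeneratePerturbations c V := h ▸ AffineSubspace.mem_top ℝ _ x
    exact hx
  have hle := finrank_vectorSpan_range_le ℝ (fun i => -restrictedDot V (c i)) (n := q - 1)
    (by simp; omega)
  rw [← direction_affineSpan, htop, AffineSubspace.direction_top, finrank_top,
    Subspace.dual_finrank_eq] at hle
  omega

lemma mem_degeneratePerturbations {q d : ℕ} {c : Fin q → Fin d → ℝ} {V : Submodule ℝ (Fin d → ℝ)}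
    {t : Fin q → ℝ} (ht : ∑ i, t i = 1) {ε : Fin d → ℝ}
    (h : ∀ v ∈ V, ∑ s, ((∑ i, t i * c i s) + ε s) * v s = 0) :
    ε ∈ degeneratePerturbations c V := by
  have hε : restrictedDot V ε = ∑ i, t i • -restrictedDot V (c i) := by
    have h0 : restrictedDot V ((∑ i, t i • c i) + ε) = 0 := by
      ext v
      simpa only [restrictedDot_apply, Pi.add_apply, Finset.sum_apply, Pi.smul_apply, smul_eq_mul,
        LinearMap.zero_apply] using h v v.2
    rw [map_add, map_sum] at h0
    simp only [map_smul] at h0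
    simp only [smul_neg, Finset.sum_neg_distrib]
    exact eq_neg_of_add_eq_zero_right h0
  change restrictedDot V ε ∈ affineSpan ℝ _
  rw [hε, ← Finset.affineCombination_eq_linear_combination _
    (fun i => -restrictedDot V (c i)) _ ht]
  exact affineCombination_mem_affineSpan ht _

lemma exists_small_generic_perturbation {q d : ℕ} {ι : Type*} [Finite ι] (hq : 0 < q)
    (c : Fin q → Fin d → ℝ) (V : ι → Submodule ℝ (Fin d → ℝ)) {α : ℝ} (hα : 0 < α) :
    ∃ ε : Fin d → ℝ, (∀ s, 0 < ε s ∧ ε s < α) ∧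
      ∀ j, q ≤ finrank ℝ (V j) → ε ∉ degeneratePerturbations c (V j) := by
  have hae : ∀ᵐ ε : Fin d → ℝ, ∀ j, q ≤ finrank ℝ (V j) →
      ε ∉ degeneratePerturbations c (V j) := by
    refine MeasureTheory.ae_all_iff.2 fun j => ?_
    by_cases hj : q ≤ finrank ℝ (V j)
    · have := MeasureTheory.Measure.addHaar_affineSubspace MeasureTheory.volume _
        (degeneratePerturbations_ne_top hq c (V j) hj)
      filter_upwards [MeasureTheory.measure_eq_zero_iff_ae_notMem.1 this] with ε hε _ using hε
    · simp [hj]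
  obtain ⟨ε, hε, hε'⟩ := (MeasureTheory.Measure.dense_of_ae hae).inter_open_nonempty
    (Set.univ.pi fun _ => Set.Ioo 0 α) (isOpen_set_pi Set.finite_univ fun _ _ => isOpen_Ioo)
    ⟨fun _ => α / 2, fun _ _ => ⟨half_pos hα, half_lt_self hα⟩⟩
  exact ⟨ε, fun s => hε s trivial, hε'⟩

lemma dot_nonpos_of_mem_optimalFace {r d : ℕ} {M : Matrix (Fin r) (Fin d) ℝ} {b : Fin r → ℝ}
    {c x v : Fin d → ℝ} (hx : x ∈ OptimalFace M b c)
    (hv : v ∈ supportedKernel M {s | x s ≠ 0}) : ∑ s, c s * v s ≤ 0 := by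
  obtain ⟨⟨hMx, hx0⟩, hopt⟩ := hx
  have hev : ∀ᶠ δ : ℝ in nhdsWithin 0 (Set.Ioi 0), ∀ s, 0 ≤ x s + δ * v s := by
    refine Filter.eventually_all.2 fun s => ?_
    by_cases hs : x s = 0
    · have := hv.2 s (by simp [hs])
      simp [hs, this]
    · have hpos : 0 < x s := (hx0 s).lt_of_ne' hs
      have hcont : Filter.Tendsto (fun δ : ℝ => x s + δ * v s) (nhds 0) (nhds (x s)) := by
        have : Continuous fun δ : ℝ => x s + δ * v s := by fun_prop
        simpa using this.tendsto 0
      exact ((hcont.eventually (lt_mem_nhds hpos)).filter_mono nhdsWithin_le_nhds).mono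
        fun _ h => h.le
  obtain ⟨δ, hδ, hδ0⟩ := (hev.and self_mem_nhdsWithin).exists
  have hle := hopt (fun s => x s + δ * v s) ⟨fun i => by
    simp [mul_add, Finset.sum_add_distrib, mul_left_comm _ δ, ← Finset.mul_sum, hMx i, hv.1 i], hδ⟩
  simp only [mul_add, Finset.sum_add_distrib, mul_left_comm _ δ, ← Finset.mul_sum] at hle
  have hδ0 : 0 < δ := hδ0
  by_contra! hpos
  have := mul_pos hδ0 hpos
  linarith

lemma dot_eq_zero_of_mem_optimalFace {r d : ℕ} {M : Matrix (Fin r) (Fin d) ℝ} {b : Fin r → ℝ}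
    {c x v : Fin d → ℝ} (hx : x ∈ OptimalFace M b c)
    (hv : v ∈ supportedKernel M {s | x s ≠ 0}) : ∑ s, c s * v s = 0 := by
  refine (dot_nonpos_of_mem_optimalFace hx hv).antisymm ?_
  simpa using dot_nonpos_of_mem_optimalFace hx (neg_mem hv)

lemma midpoint_mem_optimalFace {r d : ℕ} {M : Matrix (Fin r) (Fin d) ℝ} {b : Fin r → ℝ}
    {c x y : Fin d → ℝ} (hx : x ∈ OptimalFace M b c) (hy : y ∈ OptimalFace M b c) :
    (fun s => 2⁻¹ * (x s + y s)) ∈ OptimalFace M b c := by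
  refine ⟨⟨fun i => ?_, fun s => ?_⟩, fun z hz => ?_⟩
  · simp only [mul_left_comm _ (2⁻¹ : ℝ), ← Finset.mul_sum, mul_add, Finset.sum_add_distrib,
      hx.1.1 i, hy.1.1 i]
    ring
  · have := hx.1.2 s
    have := hy.1.2 s
    positivity
  · have h₁ := hx.2 z hz
    have h₂ := hy.2 z hz
    simp only [mul_left_comm _ (2⁻¹ : ℝ), ← Finset.mul_sum, mul_add, Finset.sum_add_distrib]
    linarith

lemma exists_mem_optimalFace_support_maximal {r d : ℕ} {M : Matrix (Fin r) (Fin d) ℝ}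
    {b : Fin r → ℝ} {c : Fin d → ℝ} (h : (OptimalFace M b c).Nonempty) :
    ∃ x ∈ OptimalFace M b c, ∀ y ∈ OptimalFace M b c, ∀ s, x s = 0 → y s = 0 := by
  obtain ⟨S, hS⟩ := (Set.toFinite
    ((fun x : Fin d → ℝ => ({s | x s ≠ 0} : Finset (Fin d))) '' OptimalFace M b c)).exists_maximal
    (h.image _)
  obtain ⟨⟨x, hx, rfl⟩, hmax⟩ := hS
  refine ⟨x, hx, fun y hy s hxs => ?_⟩
  have hle := hmax ⟨_, midpoint_mem_optimalFace hx hy, rfl⟩ fun j hj => by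
    have hxj : x j ≠ 0 := by simpa using hj
    have := (hx.1.2 j).lt_of_ne' hxj
    have := hy.1.2 j
    simp only [Finset.mem_filter, Finset.mem_univ, true_and]
    positivity
  by_contra hys
  have hmem : s ∈ ({s | x s ≠ 0} : Finset (Fin d)) := hle (by simp [hxs, hys])
  simp [hxs] at hmem

lemma direction_optimalFace_le {r d : ℕ} {M : Matrix (Fin r) (Fin d) ℝ} {b : Fin r → ℝ}
    {c : Fin d → ℝ} {S : Finset (Fin d)} (hS : ∀ y ∈ OptimalFace M b c, ∀ s ∉ S, y s = 0) :
    (affineSpan ℝ (OptimalFace M b c)).direction ≤ supportedKernel M S := by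
  rw [direction_affineSpan, vectorSpan, Submodule.span_le]
  rintro _ ⟨y, hy, z, hz, rfl⟩
  refine ⟨fun i => ?_, fun s hs => ?_⟩
  · simp [mul_sub, Finset.sum_sub_distrib, hy.1.1 i, hz.1.1 i]
  · simp [hS y hy s hs, hS z hz s hs]

/-- Given vectors `c^1, …, c^q` in `ℝ^d`, a matrix `M` and a vector `b`, one can choose
arbitrarily small `ε_s > 0` such that for every `t'` in the standard simplex, the optimal face
of the LP `max c(t')·x s.t. Mx = b, x ≥ 0`, where `c_s(t') = Σ_i t'_i c^i_s + ε_s`, has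
affine dimension at most `q − 1`. -/
theorem statement8 (q r d : ℕ) (c : Fin q → Fin d → ℝ) (M : Matrix (Fin r) (Fin d) ℝ)
    (b : Fin r → ℝ) (α : ℝ) (hα : 0 < α) :
    ∃ ε : Fin d → ℝ, (∀ s, 0 < ε s ∧ ε s < α) ∧
      ∀ t' : Fin q → ℝ, (∀ i, 0 ≤ t' i) → (∑ i, t' i = 1) →
        Module.finrank ℝ
          (affineSpan ℝ (OptimalFace M b (fun s => (∑ i, t' i * c i s) + ε s))).direction ≤
          q - 1 := by
  rcases Nat.eq_zero_or_pos q with rfl | hq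
  · exact ⟨fun _ => α / 2, fun _ => ⟨half_pos hα, half_lt_self hα⟩, fun t' _ ht => by simp at ht⟩
  obtain ⟨ε, hε, hgen⟩ := exists_small_generic_perturbation hq c (supportedKernel M) hα
  refine ⟨ε, hε, fun t' _ ht => ?_⟩
  rcases (OptimalFace M b fun s => (∑ i, t' i * c i s) + ε s).eq_empty_or_nonempty with he | hne
  · rw [he, direction_affineSpan, vectorSpan_empty, finrank_bot]
    exact Nat.zero_le _
  obtain ⟨x, hx, hmax⟩ := exists_mem_optimalFace_support_maximal hne
  refine (Submodule.finrank_mono (direction_optimalFace_le (S := {s | x s ≠ 0})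
    fun y hy s hs => hmax y hy s (by simpa using hs))).trans ?_
  by_contra! hlt
  exact hgen _ (by omega) (mem_degeneratePerturbations ht
    fun v hv => dot_eq_zero_of_mem_optimalFace hx hv)
end
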